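/- arXiv:math/0608415 — 3 statements merged into one kernel-verified Lean document; each statement's English description precedes it below -/
import Mathlib

section
/- Let f be a nonsingular quadratic form with rational coefficients in n ≥ 4 variables which is indefinite, and let b be a nonzero rational number. Then there exists a nonzero vector v ∈ ℚ^n with f(v) = b. -/
namespace Paper

open Matrix

/-- Value at `x` of the quadratic form with Gram matrix `Q`. -/
def qeval {m : ℕ} {R : Type*} [CommRing R] (Q : Matrix (Fin m) (Fin m) R) (x : Fin m → R) : R :=
  x ⬝ᵥ (Q *ᵥ x)

/-- The polar bilinear form `B(x,y) = (f(x+y) - f(x) - f(y))/2` of the quadratic form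
with Gram matrix `Q`. -/
def qpolar {m : ℕ} {K : Type*} [Field K] (Q : Matrix (Fin m) (Fin m) K) (x y : Fin m → K) : K :=
  (qeval Q (x + y) - qeval Q x - qeval Q y) / 2

/-- A real quadratic form (given by its Gram matrix `Q`) has signature `(r,s)`:
`r + s = m` and it is linearly equivalent over `ℝ` to
`x_1^2 + ... + x_r^2 - x_{r+1}^2 - ... - x_m^2`. -/
def RealSignature {m : ℕ} (Q : Matrix (Fin m) (Fin m) ℝ) (r s : ℕ) : Prop :=
  r + s = m ∧ ∃ T : Matrix (Fin m) (Fin m) ℝ, T.det ≠ 0 ∧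
    ∀ x : Fin m → ℝ, qeval Q (T *ᵥ x) = ∑ i : Fin m, (if (i : ℕ) < r then (x i)^2 else -(x i)^2)

/-- A rational quadratic form has signature `(r,s)` if it does as a real quadratic form. -/
def HasSignature {m : ℕ} (Q : Matrix (Fin m) (Fin m) ℚ) (r s : ℕ) : Prop :=
  RealSignature (Q.map (Rat.cast : ℚ → ℝ)) r s

/-- The rational quadratic form `F` (in `n` variables) represents the rational quadratic
form `G` (in `k` variables): after a linear change of coordinates over `ℚ`,
`F(x_1,...,x_n) = G(x_1,...,x_k) + H(x_{k+1},...,x_n)` for some rational quadratic form `H`. -/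
def Represents {n k : ℕ} (F : Matrix (Fin n) (Fin n) ℚ) (G : Matrix (Fin k) (Fin k) ℚ) : Prop :=
  ∃ (m : ℕ) (hm : n = k + m) (H : Matrix (Fin m) (Fin m) ℚ) (T : Matrix (Fin n) (Fin n) ℚ),
    T.det ≠ 0 ∧ ∀ (x : Fin k → ℚ) (y : Fin m → ℚ),
      qeval F (T *ᵥ (Fin.append x y ∘ Fin.cast hm)) = qeval G x + qeval H y

/-- The group `O(f, A)` of matrices in `GL(m, A)` preserving the quadratic form `f`
(with Gram matrix `Q` over `K ⊇ A`): those `M` with `f(Mx) = f(x)` for all `x`. -/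
def ortho {m : ℕ} (A : Type*) [CommRing A] {K : Type*} [Field K] [Algebra A K]
    (Q : Matrix (Fin m) (Fin m) K) : Subgroup (GL (Fin m) A) where
  carrier := { M | ∀ x : Fin m → K,
      qeval Q (((M : Matrix (Fin m) (Fin m) A).map (algebraMap A K)) *ᵥ x) = qeval Q x }
  one_mem' := by
    intro x
    have h1 : ((1 : GL (Fin m) A) : Matrix (Fin m) (Fin m) A).map (algebraMap A K) = 1 := by
      simp [Matrix.map_one]
    rw [h1, Matrix.one_mulVec]
  mul_mem' := by
    intro a b ha hb x
    have h : ((a * b : GL (Fin m) A) : Matrix (Fin m) (Fin m) A).map (algebraMap A K)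
        = ((a : Matrix (Fin m) (Fin m) A).map (algebraMap A K)) *
          ((b : Matrix (Fin m) (Fin m) A).map (algebraMap A K)) := by
      rw [Units.val_mul, Matrix.map_mul]
    rw [h, ← Matrix.mulVec_mulVec, ha, hb]
  inv_mem' := by
    intro a ha x
    set M := ((a : Matrix (Fin m) (Fin m) A).map (algebraMap A K)) with hM
    set N := (((a⁻¹ : GL (Fin m) A) : Matrix (Fin m) (Fin m) A).map (algebraMap A K)) with hN
    have hMN : M * N = 1 := by
      rw [hM, hN, ← Matrix.map_mul]
      have : (a : Matrix (Fin m) (Fin m) A) * ((a⁻¹ : GL (Fin m) A) : Matrix (Fin m) (Fin m) A)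
          = 1 := a.mul_inv
      rw [this]
      simp [Matrix.map_one]
    have ha' : ∀ y : Fin m → K, qeval Q (M *ᵥ y) = qeval Q y := ha
    calc qeval Q (N *ᵥ x) = qeval Q (M *ᵥ (N *ᵥ x)) := (ha' (N *ᵥ x)).symm
      _ = qeval Q ((M * N) *ᵥ x) := by rw [Matrix.mulVec_mulVec]
      _ = qeval Q x := by rw [hMN, Matrix.one_mulVec]

/-- `O(f, ℤ)` for a rational quadratic form `f` with Gram matrix `Q`. -/
abbrev OZ {m : ℕ} (Q : Matrix (Fin m) (Fin m) ℚ) : Subgroup (GL (Fin m) ℤ) := ortho ℤ Q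

/-- A group is finitely presented: it is a quotient of a finitely generated free group by
the normal closure of a finite set of relators. -/
def IsFinitelyPresented (G : Type*) [Group G] : Prop :=
  ∃ (n : ℕ) (rels : Set (FreeGroup (Fin n))), rels.Finite ∧ Nonempty (PresentedGroup rels ≃* G)

/-- A group is coherent if each of its finitely generated subgroups is finitely presented. -/
def IsCoherent (G : Type*) [Group G] : Prop :=
  ∀ H : Subgroup G, Group.FG H → IsFinitelyPresented H

/-- Two groups are abstractly commensurable if they contain isomorphic
subgroups of finite index. -/
def AbstractlyCommensurable (G H : Type*) [Group G] [Group H] : Prop :=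
  ∃ (G' : Subgroup G) (H' : Subgroup H), G'.FiniteIndex ∧ H'.FiniteIndex ∧ Nonempty (G' ≃* H')

/-- The form `q₃ = -x₀² + x₁² + x₂² + x₃²`. -/
def q3 : Matrix (Fin 4) (Fin 4) ℚ := Matrix.diagonal ![-1, 1, 1, 1]

/-- Relations of the Witt group presentation. -/
def wrel (R : Type) [CommRing R] : Set (FreeAbelianGroup R) :=
  {x | x = FreeAbelianGroup.of 0 ∨
    (∃ a b : R, x = FreeAbelianGroup.of a + FreeAbelianGroup.of b
      - (FreeAbelianGroup.of (a + b) + FreeAbelianGroup.of (a * b * (a + b)))) ∨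
    (∃ a c : R, c ≠ 0 ∧ x = FreeAbelianGroup.of (a * c ^ 2) - FreeAbelianGroup.of a)}

/-- The Witt group given by generators and relations. -/
abbrev WG (R : Type) [CommRing R] : Type :=
  FreeAbelianGroup R ⧸ AddSubgroup.closure (wrel R)

/-- The generator of a one-dimensional form. -/
def wg {R : Type} [CommRing R] (a : R) : WG R :=
  QuotientAddGroup.mk (FreeAbelianGroup.of a)

section
variable {R : Type} [CommRing R]

theorem wmk_zero_of_mem {x : FreeAbelianGroup R} (h : x ∈ wrel R) :
    (QuotientAddGroup.mk x : WG R) = 0 :=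
  (QuotientAddGroup.eq_zero_iff x).2 (AddSubgroup.subset_closure h)

theorem wg_zero : wg (0 : R) = 0 := wmk_zero_of_mem (Or.inl rfl)

theorem wg_add (a b : R) : wg a + wg b = wg (a + b) + wg (a * b * (a + b)) := by
  have := wmk_zero_of_mem (R := R) (Or.inr (Or.inl ⟨a, b, rfl⟩))
  exact sub_eq_zero.1 this

theorem wg_sq (a c : R) (hc : c ≠ 0) : wg (a * c ^ 2) = wg a := by
  have := wmk_zero_of_mem (R := R) (Or.inr (Or.inr ⟨a, c, hc, rfl⟩))
  exact sub_eq_zero.1 this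

theorem wg_neg (a : R) : wg (-a) = - wg a := by
  have := wg_add a (-a)
  simp only [add_neg_cancel, mul_zero, wg_zero, add_zero] at this
  exact eq_neg_of_add_eq_zero_right this

/-- Universal property. -/
def wlift {G : Type*} [AddCommGroup G] (f : R → G) (h0 : f 0 = 0)
    (h1 : ∀ a b, f a + f b = f (a + b) + f (a * b * (a + b)))
    (h2 : ∀ a c, c ≠ 0 → f (a * c ^ 2) = f a) : WG R →+ G :=
  QuotientAddGroup.lift _ (FreeAbelianGroup.lift f) (by
    rw [AddSubgroup.closure_le]
    rintro x (rfl | ⟨a, b, rfl⟩ | ⟨a, c, hc, rfl⟩)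
    · simp [h0]
    · simp [h1 a b]
    · simp [h2 a c hc])

@[simp] theorem wlift_wg {G : Type*} [AddCommGroup G] (f : R → G) (h0) (h1) (h2) (a : R) :
    wlift f h0 h1 h2 (wg a) = f a := by
  simp [wlift, wg]

theorem wg_closure : AddSubgroup.closure (Set.range (wg : R → WG R)) = ⊤ := by
  rw [eq_top_iff]
  intro x _
  obtain ⟨y, rfl⟩ := QuotientAddGroup.mk_surjective x
  induction y using FreeAbelianGroup.induction_on with
  | zero => exact zero_mem _
  | of a => exact AddSubgroup.subset_closure ⟨a, rfl⟩
  | neg a h => exact neg_mem (h trivial)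
  | add x y hx hy => exact add_mem (hx trivial) (hy trivial)

theorem wg_induction {P : WG R → Prop} (h0 : P 0) (h1 : ∀ a x, P x → P (wg a + x)) (x : WG R) :
    P x := by
  have hx : x ∈ AddSubgroup.closure (Set.range (wg : R → WG R)) := by
    rw [wg_closure]; trivial
  induction hx using AddSubgroup.closure_induction_left with
  | zero => exact h0
  | add_left x hx y hy ih => 
    obtain ⟨a, rfl⟩ := hx
    exact h1 a _ ih
  | neg_add_cancel x hx y hy ih =>
    obtain ⟨a, rfl⟩ := hx
    rw [← wg_neg]
    exact h1 _ _ ih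
end

/-- Signature. -/
def wsig : WG ℤ →+ ℤ := wlift Int.sign (by simp)
  (by
    intro a b
    rcases lt_trichotomy a 0 with ha | ha | ha <;> rcases lt_trichotomy b 0 with hb | hb | hb <;>
    rcases lt_trichotomy (a + b) 0 with hab | hab | hab <;>
    simp_all [Int.sign_mul, Int.sign_eq_one_of_pos, Int.sign_eq_neg_one_of_neg] <;> omega)
  (by
    intro a c hc
    have : 0 < c ^ 2 := by positivity
    simp only [Int.sign_mul, Int.sign_eq_one_of_pos this, mul_one])

/-- Scaling. -/
def wscale (n : ℤ) (hn : n ≠ 0) : WG ℤ →+ WG ℤ := wlift (fun a => wg (n * a)) (by simp [wg_zero])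
  (by
    intro a b
    rw [wg_add, ← wg_sq (n * (a * b * (a + b))) n hn]
    congr 2 <;> ring)
  (by
    intro a c hc
    rw [← mul_assoc, wg_sq _ _ hc])

/-- Smooth integers: all prime factors below `p`. -/
def Sm (p : ℕ) (n : ℤ) : Prop := n ≠ 0 ∧ ∀ r : ℕ, r.Prime → (r : ℤ) ∣ n → r < p

/-- The filtration. -/
def LL (p : ℕ) : AddSubgroup (WG ℤ) := AddSubgroup.closure {x | ∃ n, Sm p n ∧ x = wg n}

theorem Sm.mul {p : ℕ} {a b : ℤ} (ha : Sm p a) (hb : Sm p b) : Sm p (a * b) := by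
  refine ⟨mul_ne_zero ha.1 hb.1, fun r hr h => ?_⟩
  rcases (Nat.prime_iff_prime_int.1 hr).dvd_or_dvd h with h | h
  · exact ha.2 r hr h
  · exact hb.2 r hr h

theorem Sm.of_mul {p : ℕ} {a b : ℤ} (h : Sm p (a * b)) : Sm p b :=
  ⟨right_ne_zero_of_mul h.1, fun r hr h' => h.2 r hr (h'.mul_left a)⟩

theorem Sm.of_lt {p : ℕ} {a : ℤ} (h0 : a ≠ 0) (h : |a| < p) : Sm p a := by
  refine ⟨h0, fun r hr h' => ?_⟩
  have := Int.le_of_dvd (abs_pos.2 h0) ((dvd_abs _ _).2 h')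
  omega

theorem LL_mem {p : ℕ} {a : ℤ} (h : Sm p a) : wg a ∈ LL p :=
  AddSubgroup.subset_closure ⟨a, h, rfl⟩

theorem LL_mono {p q : ℕ} (h : p ≤ q) : LL p ≤ LL q := by
  apply AddSubgroup.closure_mono
  rintro x ⟨n, hn, rfl⟩
  exact ⟨n, ⟨hn.1, fun r hr h' => (hn.2 r hr h').trans_le h⟩, rfl⟩

theorem LL_exists (x : WG ℤ) : ∃ k, x ∈ LL k := by
  induction x using wg_induction with
  | h0 => exact ⟨0, zero_mem _⟩
  | h1 a x ih =>
    obtain ⟨k, hk⟩ := ih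
    by_cases ha : a = 0
    · exact ⟨k, by simpa [ha, wg_zero] using hk⟩
    refine ⟨max k (a.natAbs + 1), add_mem (LL_mem ⟨ha, fun r hr h => ?_⟩) (LL_mono (le_max_left _ _) hk)⟩
    have := Nat.le_of_dvd (Int.natAbs_pos.2 ha) (Int.natCast_dvd.1 h)
    omega

theorem LL_scale {p : ℕ} {n : ℤ} (hn : Sm p n) {x : WG ℤ} (hx : x ∈ LL p) :
    wscale n hn.1 x ∈ LL p := by
  induction hx using AddSubgroup.closure_induction with
  | mem x h => 
    obtain ⟨m, hm, rfl⟩ := h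
    simp only [wscale, wlift_wg]
    exact LL_mem (hn.mul hm)
  | zero => simp [zero_mem]
  | add x y _ _ h1 h2 => rw [map_add]; exact add_mem h1 h2
  | neg x _ h => rw [map_neg]; exact neg_mem h

theorem keyA {p : ℕ} (hp : p.Prime) {a b r : ℤ} (ha : a ≠ 0) (hb : b ≠ 0) (hr : r ≠ 0)
    (ha' : |a| < p) (hb' : |b| < p) (hr' : |r| < p) (h : (p : ℤ) ∣ a * b - r) :
    wg (p * (a * b)) - wg (p * r) ∈ LL p := by
  obtain ⟨l, hl⟩ := h
  have hp0 : (p : ℤ) ≠ 0 := by exact_mod_cast hp.ne_zero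
  have hpp : (0 : ℤ) < p := by exact_mod_cast hp.pos
  have hl' : |l| < p := by
    have h1 : |(p : ℤ) * l| ≤ (p - 1) * (p - 1) + (p - 1) := by
      rw [← hl]
      refine (abs_sub _ _).trans ?_
      rw [abs_mul]
      have : |a| * |b| ≤ (p - 1) * (p - 1) :=
        mul_le_mul (by omega) (by omega) (abs_nonneg _) (by omega)
      omega
    rw [abs_mul, abs_of_pos hpp] at h1
    nlinarith
  have h1 := wg_add ((p : ℤ) * r) (p * (p * l))
  have h2 : (p : ℤ) * r + p * (p * l) = p * (a * b) := by rw [← hl]; ring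
  have h3 : (p : ℤ) * r * (p * (p * l)) * (p * r + p * (p * l)) = (r * l * (a * b)) * (p ^ 2) ^ 2 := by
    rw [h2]; ring
  have h4 : (p : ℤ) * (p * l) = l * p ^ 2 := by ring
  rw [h3, wg_sq _ _ (pow_ne_zero 2 hp0), h2, h4, wg_sq _ _ hp0] at h1
  have h5 : wg ((p : ℤ) * (a * b)) - wg (p * r) = wg l - wg (r * l * (a * b)) := by
    rw [sub_eq_sub_iff_add_eq_add, ← h1, add_comm]
  rw [h5]
  by_cases hl0 : l = 0
  · simp [hl0, wg_zero, zero_mem]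
  have sl := Sm.of_lt hl0 hl'
  exact sub_mem (LL_mem sl) (LL_mem (((Sm.of_lt hr hr').mul sl).mul
    ((Sm.of_lt ha ha').mul (Sm.of_lt hb hb'))))

theorem keyB {p : ℕ} (hp : p.Prime) : ∀ (k : ℕ) {n r : ℤ}, n.natAbs ≤ k → Sm p n → r ≠ 0 → |r| < p →
    (p : ℤ) ∣ n - r → wg (p * n) - wg (p * r) ∈ LL p := by
  have hpp : (1 : ℤ) < p := by exact_mod_cast hp.one_lt
  intro k
  induction k with
  | zero => intro n r h hn; exact absurd (by omega) hn.1
  | succ k ih =>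
    intro n r hk hn hr hr' h
    by_cases hlt : |n| < p
    · have := keyA hp hn.1 one_ne_zero hr hlt (by simpa using hpp) hr' (by simpa using h)
      simpa using this
    have hn1 : n.natAbs ≠ 1 := by
      intro h1
      rw [Int.abs_eq_natAbs, h1] at hlt
      exact hlt (by simpa using hpp)
    obtain ⟨s, hs, m, rfl⟩ : ∃ s : ℕ, s.Prime ∧ (s : ℤ) ∣ n := 
      ⟨_, Nat.minFac_prime hn1, Int.natCast_dvd.2 (Nat.minFac_dvd _)⟩
    have hsp : s < p := hn.2 s hs (dvd_mul_right _ _)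
    have hs0 : (s : ℤ) ≠ 0 := by exact_mod_cast hs.ne_zero
    have hm := hn.of_mul
    have hsS : Sm p s := Sm.of_lt hs0 (by simpa using hsp)
    have hpm : ¬ (p : ℤ) ∣ m := fun h => lt_irrefl _ (hm.2 p hp h)
    have ht0 : m % p ≠ 0 := fun h => hpm (Int.dvd_of_emod_eq_zero h)
    have ht1 : |m % p| < p := by
      rw [abs_of_nonneg (Int.emod_nonneg _ (by omega))]
      exact Int.emod_lt_of_pos _ (by omega)
    have hdv : (p : ℤ) ∣ m - m % p := Int.dvd_self_sub_emod
    have hmk : m.natAbs ≤ k := by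
      have := hs.two_le
      have h1 := Int.natAbs_mul s m
      have h2 := Int.natAbs_pos.2 hm.1
      simp only [Int.natAbs_natCast] at h1
      nlinarith
    have h1 := LL_scale hsS (ih hmk hm ht0 ht1 hdv)
    rw [map_sub] at h1
    simp only [wscale, wlift_wg] at h1
    have h2 := keyA hp hs0 ht0 hr (by simpa using hsp) ht1 hr' (by
      have : (s : ℤ) * (m % p) - r = (s * m - r) - s * (m - m % p) := by ring
      rw [this]
      exact dvd_sub h (hdv.mul_left _))
    have h3 := add_mem h1 h2
    have e1 : (s : ℤ) * (p * m) = p * (s * m) := by ring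
    have e2 : (s : ℤ) * (p * (m % p)) = p * (s * (m % p)) := by ring
    rw [e1, e2] at h3
    simpa using h3

/-- Residue of a generator. -/
noncomputable def rfun (p : ℕ) (a : ℤ) : WG (ZMod p) :=
  if Odd (padicValInt p a) then wg ((a / (p : ℤ) ^ padicValInt p a : ℤ) : ZMod p) else 0

theorem rfun_zero (p : ℕ) : rfun p 0 = 0 := by simp [rfun]

theorem rfun_eq (p : ℕ) [hp : Fact p.Prime] (v : ℕ) {u : ℤ} (hu : ¬ (p : ℤ) ∣ u) :
    rfun p ((p : ℤ) ^ v * u) = if Odd v then wg (u : ZMod p) else 0 := by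
  have hu0 : u ≠ 0 := by rintro rfl; exact hu (dvd_zero _)
  have hp0 : (p : ℤ) ≠ 0 := by exact_mod_cast hp.out.ne_zero
  have h : padicValInt p ((p : ℤ) ^ v * u) = v := by
    rw [padicValInt.mul (pow_ne_zero _ hp0) hu0, padicValInt.eq_zero_of_not_dvd hu]
    have : ((p : ℤ) ^ v) = ((p ^ v : ℕ) : ℤ) := by push_cast; rfl
    rw [this, padicValInt.of_nat, padicValNat.prime_pow, add_zero]
  rw [rfun, h, Int.mul_ediv_cancel_left _ (pow_ne_zero _ hp0)]

theorem exists_decomp (p : ℕ) [hp : Fact p.Prime] {a : ℤ} (ha : a ≠ 0) :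
    ∃ (v : ℕ) (u : ℤ), ¬ (p : ℤ) ∣ u ∧ a = (p : ℤ) ^ v * u := by
  have : FiniteMultiplicity (p : ℤ) a := 
    Int.finiteMultiplicity_iff.2 ⟨by simpa using hp.out.ne_one, ha⟩
  obtain ⟨c, hc, hc'⟩ := this.exists_eq_pow_mul_and_not_dvd
  exact ⟨_, c, hc', hc⟩

theorem nd_mul {p : ℕ} [hp : Fact p.Prime] {a b : ℤ} (ha : ¬ (p : ℤ) ∣ a) (hb : ¬ (p : ℤ) ∣ b) :
    ¬ (p : ℤ) ∣ a * b := fun h =>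
  ((Nat.prime_iff_prime_int.1 hp.out).dvd_or_dvd h).elim ha hb

theorem cast_ne {p : ℕ} {a : ℤ} (ha : ¬ (p : ℤ) ∣ a) : (a : ZMod p) ≠ 0 := by
  rwa [Ne, ZMod.intCast_zmod_eq_zero_iff_dvd]

theorem rfun_add_aux (p : ℕ) [hp : Fact p.Prime] {u t : ℤ} (v k : ℕ)
    (hu : ¬ (p : ℤ) ∣ u) (ht : ¬ (p : ℤ) ∣ t) :
    rfun p ((p : ℤ) ^ v * u) + rfun p ((p : ℤ) ^ (v + k) * t) =
    rfun p ((p : ℤ) ^ v * u + (p : ℤ) ^ (v + k) * t) + rfun p ((p : ℤ) ^ v * u *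
      ((p : ℤ) ^ (v + k) * t) * ((p : ℤ) ^ v * u + (p : ℤ) ^ (v + k) * t)) := by
  have hcu := cast_ne hu
  have hct := cast_ne ht
  rcases Nat.eq_zero_or_pos k with rfl | hk
  · by_cases h : (p : ℤ) ∣ u + t
    · have hut : (t : ZMod p) = - u := by
        have := (ZMod.intCast_zmod_eq_zero_iff_dvd _ p).2 h
        push_cast at this
        linear_combination this
      have hl : rfun p ((p : ℤ) ^ v * u) + rfun p ((p : ℤ) ^ (v + 0) * t) = 0 := by
        rw [rfun_eq p _ hu, rfun_eq p _ ht, hut, wg_neg]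
        simp only [add_zero]
        split_ifs <;> simp
      rw [hl]
      by_cases h0 : u + t = 0
      · have : (p : ℤ) ^ v * u + (p : ℤ) ^ (v + 0) * t = 0 := by
          simp only [add_zero]; rw [← mul_add, h0, mul_zero]
        rw [this, mul_zero, rfun_zero, add_zero]
      · obtain ⟨j, s, hs, hj⟩ := exists_decomp p h0
        have e1 : (p : ℤ) ^ v * u + (p : ℤ) ^ (v + 0) * t = (p : ℤ) ^ (v + j) * s := by
          rw [pow_add _ v j, mul_assoc, ← hj]; simp only [add_zero]; ring
        have e2 : (p : ℤ) ^ v * u * ((p : ℤ) ^ (v + 0) * t) * ((p : ℤ) ^ (v + j) * s) =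
          (p : ℤ) ^ (2 * v + (v + j)) * (u * t * s) := by ring
        rw [e1, e2, rfun_eq p _ hs, rfun_eq p _ (nd_mul (nd_mul hu ht) hs)]
        have e3 : ((u * t * s : ℤ) : ZMod p) = (-(s : ZMod p)) * (u : ZMod p) ^ 2 := by
          push_cast; rw [hut]; ring
        rw [e3, wg_sq _ _ hcu, wg_neg]
        have e4 : Odd (2 * v + (v + j)) ↔ Odd (v + j) := by
          simp only [Nat.odd_iff]; omega
        simp only [e4]
        split_ifs <;> simp
    · have e1 : (p : ℤ) ^ v * u + (p : ℤ) ^ (v + 0) * t = (p : ℤ) ^ v * (u + t) := by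
        simp only [add_zero]; ring
      have e2 : (p : ℤ) ^ v * u * ((p : ℤ) ^ (v + 0) * t) * ((p : ℤ) ^ v * (u + t)) =
          (p : ℤ) ^ (2 * v + v) * (u * t * (u + t)) := by ring
      rw [e1, e2, rfun_eq p _ hu, rfun_eq p _ ht, rfun_eq p _ h, rfun_eq p _ (nd_mul (nd_mul hu ht) h)]
      have e4 : Odd (2 * v + v) ↔ Odd v := by
        simp only [Nat.odd_iff]; omega
      simp only [e4, add_zero]
      split_ifs
      · push_cast; exact wg_add _ _
      · rfl
  · have hpk : (p : ℤ) ∣ p ^ k * t := (dvd_pow_self _ hk.ne').mul_right _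
    have h : ¬ (p : ℤ) ∣ u + p ^ k * t := fun h => hu ((dvd_add_left hpk).1 h)
    have hc : ((u + p ^ k * t : ℤ) : ZMod p) = u := by
      rw [Int.cast_add, (ZMod.intCast_zmod_eq_zero_iff_dvd _ p).2 hpk, add_zero]
    have e1 : (p : ℤ) ^ v * u + (p : ℤ) ^ (v + k) * t = (p : ℤ) ^ v * (u + p ^ k * t) := by ring
    have e2 : (p : ℤ) ^ v * u * ((p : ℤ) ^ (v + k) * t) * ((p : ℤ) ^ v * (u + p ^ k * t)) =
          (p : ℤ) ^ (2 * v + (v + k)) * (u * t * (u + p ^ k * t)) := by ring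
    rw [e1, e2, rfun_eq p _ hu, rfun_eq p _ ht, rfun_eq p _ h, rfun_eq p _ (nd_mul (nd_mul hu ht) h)]
    have e4 : Odd (2 * v + (v + k)) ↔ Odd (v + k) := by
      simp only [Nat.odd_iff]; omega
    have e3 : ((u * t * (u + p ^ k * t) : ℤ) : ZMod p) = (t : ZMod p) * (u : ZMod p) ^ 2 := by
      rw [Int.cast_mul, hc]; push_cast; ring
    simp only [e4, e3, hc]
    rw [wg_sq _ _ hcu]

theorem rfun_add (p : ℕ) [hp : Fact p.Prime] (a b : ℤ) :
    rfun p a + rfun p b = rfun p (a + b) + rfun p (a * b * (a + b)) := by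
  by_cases ha : a = 0
  · simp [ha, rfun_zero]
  by_cases hb : b = 0
  · simp [hb, rfun_zero]
  obtain ⟨v, u, hu, rfl⟩ := exists_decomp p ha
  obtain ⟨w, t, ht, rfl⟩ := exists_decomp p hb
  rcases le_total v w with h | h
  · obtain ⟨k, rfl⟩ := Nat.exists_eq_add_of_le h
    exact rfun_add_aux p v k hu ht
  · obtain ⟨k, rfl⟩ := Nat.exists_eq_add_of_le h
    have := rfun_add_aux p w k ht hu
    rw [add_comm, this]
    congr 2 <;> ring

/-- The residue homomorphism. -/
noncomputable def wres (p : ℕ) [hp : Fact p.Prime] : WG ℤ →+ WG (ZMod p) :=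
  wlift (rfun p) (rfun_zero p) (rfun_add p) (by
    intro a c hc
    by_cases ha : a = 0
    · simp [ha]
    obtain ⟨v, u, hu, rfl⟩ := exists_decomp p ha
    obtain ⟨w, t, ht, rfl⟩ := exists_decomp p hc
    have e : (p : ℤ) ^ v * u * ((p : ℤ) ^ w * t) ^ 2 = (p : ℤ) ^ (2 * w + v) * (u * (t * t)) := by
      ring
    have e4 : Odd (2 * w + v) ↔ Odd v := by
      simp only [Nat.odd_iff]; omega
    have e3 : ((u * (t * t) : ℤ) : ZMod p) = (u : ZMod p) * (t : ZMod p) ^ 2 := by push_cast; ring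
    rw [e, rfun_eq p _ hu, rfun_eq p _ (nd_mul hu (nd_mul ht ht)), e3, wg_sq _ _ (cast_ne ht)]
    simp only [e4])

theorem wres_wg (p : ℕ) [hp : Fact p.Prime] (a : ℤ) : wres p (wg a) = rfun p a := by
  simp [wres]

theorem wres_unit (p : ℕ) [hp : Fact p.Prime] {a : ℤ} (ha : ¬ (p : ℤ) ∣ a) : wres p (wg a) = 0 := by
  have := rfun_eq p 0 ha
  simpa [wres_wg] using this

theorem wres_odd (p : ℕ) [hp : Fact p.Prime] {a : ℤ} (ha : ¬ (p : ℤ) ∣ a) :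
    wres p (wg (p * a)) = wg (a : ZMod p) := by
  have := rfun_eq p 1 ha
  simpa [wres_wg] using this

theorem wres_LL (p : ℕ) [hp : Fact p.Prime] {x : WG ℤ} (hx : x ∈ LL p) : wres p x = 0 := by
  induction hx using AddSubgroup.closure_induction with
  | mem x h => 
    obtain ⟨m, hm, rfl⟩ := h
    exact wres_unit p (fun h => lt_irrefl _ (hm.2 p hp.out h))
  | zero => simp
  | add x y _ _ h1 h2 => rw [map_add, h1, h2, add_zero]
  | neg x _ h => rw [map_neg, h, neg_zero]

theorem small_val {p : ℕ} [hp : Fact p.Prime] {u : ZMod p} (hu : u ≠ 0) :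
    (u.val : ℤ) ≠ 0 ∧ |(u.val : ℤ)| < p := by
  refine ⟨by exact_mod_cast (ZMod.val_ne_zero u).2 hu, ?_⟩
  rw [abs_of_nonneg (by positivity)]
  exact_mod_cast ZMod.val_lt u

/-- class depends only on the residue -/
theorem keyC {p : ℕ} [hp : Fact p.Prime] {n : ℤ} (hn : n = 0 ∨ Sm p n) {u : ZMod p} (h : (n : ZMod p) = u) :
    (QuotientAddGroup.mk (wg ((p : ℤ) * u.val)) : WG ℤ ⧸ LL p) = QuotientAddGroup.mk (wg (p * n)) := by
  rcases hn with rfl | hn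
  · simp only [Int.cast_zero] at h
    simp [← h]
  have hu : u ≠ 0 := by
    rw [← h]
    exact cast_ne (fun h => lt_irrefl _ (hn.2 p hp.out h))
  rw [QuotientAddGroup.eq, neg_add_eq_sub]
  refine keyB hp.out _ le_rfl hn (small_val hu).1 (small_val hu).2 ?_
  rw [← ZMod.intCast_zmod_eq_zero_iff_dvd]
  push_cast
  simp [h]

/-- Inverse of the residue map on the graded piece. -/
noncomputable def wback (p : ℕ) [hp : Fact p.Prime] : WG (ZMod p) →+ (WG ℤ ⧸ LL p) :=
  wlift (fun u => QuotientAddGroup.mk (wg ((p : ℤ) * u.val))) (by simp [wg_zero]) (by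
      intro a b
      by_cases ha : a = 0
      · subst ha; simp [wg_zero]; exact add_comm _ _
      by_cases hb : b = 0
      · simp [hb, wg_zero]
      obtain ⟨n, m, hn, hm, hnm, hn', hm', hnm'⟩ : ∃ n m : ℤ, n ≠ 0 ∧ m ≠ 0 ∧ |n + m| < p ∧ 
          |n| < p ∧ |m| < p ∧ ((n : ZMod p) = a ∧ (m : ZMod p) = b) := by
        refine ⟨a.val, b.val - p, (small_val ha).1, ?_, ?_, (small_val ha).2, ?_, by simp, by simp⟩ 
        all_goals
          have h1 := ZMod.val_lt a
          have h2 := ZMod.val_lt b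
          have h3 := (small_val ha).1
          have h4 := (small_val hb).1
          try rw [abs_lt]
          try constructor
          all_goals omega
      obtain ⟨rfl, rfl⟩ := hnm'
      have sn := Sm.of_lt hn hn'
      have sm := Sm.of_lt hm hm'
      have snm : n + m = 0 ∨ Sm p (n + m) := by
        by_cases h : n + m = 0
        · exact Or.inl h
        · exact Or.inr (Sm.of_lt h hnm)
      have snm' : n * m * (n + m) = 0 ∨ Sm p (n * m * (n + m)) := by
        rcases snm with h | h
        · left; rw [h, mul_zero]
        · right; exact (sn.mul sm).mul h
      have hp0 : (p : ℤ) ≠ 0 := by exact_mod_cast hp.out.ne_zero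
      rw [keyC (Or.inr sn) rfl, keyC (Or.inr sm) rfl, keyC snm (by push_cast; rfl),
        keyC snm' (by push_cast; rfl), ← QuotientAddGroup.mk_add, ← QuotientAddGroup.mk_add, wg_add]
      have e : (p : ℤ) * n * (p * m) * (p * n + p * m) = (p * (n * m * (n + m))) * p ^ 2 := by ring
      rw [e, wg_sq _ _ hp0]
      congr 3
      ring) (by
      intro a c hc
      by_cases ha : a = 0
      · simp [ha]
      obtain ⟨c1, c2⟩ := small_val hc
      obtain ⟨a1, a2⟩ := small_val ha
      have s := (Sm.of_lt a1 a2).mul ((Sm.of_lt c1 c2).mul (Sm.of_lt c1 c2))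
      rw [keyC (Or.inr s) (u := a * c ^ 2) (by push_cast; simp [pow_two])]
      have e : (p : ℤ) * (a.val * (c.val * c.val)) = (p * a.val) * (c.val : ℤ) ^ 2 := by ring
      rw [e, wg_sq _ _ c1])

theorem wback_wres (p : ℕ) [hp : Fact p.Prime] {x : WG ℤ} (hx : x ∈ LL (p + 1)) : 
    wback p (wres p x) = QuotientAddGroup.mk x := by
  induction hx using AddSubgroup.closure_induction with
  | mem x h => 
    obtain ⟨n, hn, rfl⟩ := h
    obtain ⟨v, u, hu, rfl⟩ := exists_decomp p hn.1
    have hp0 : (p : ℤ) ≠ 0 := by exact_mod_cast hp.out.ne_zero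
    have hu' : Sm p u := by
      refine ⟨hn.of_mul.1, fun r hr h => ?_⟩
      have h1 := hn.of_mul.2 r hr h
      have h2 : r ≠ p := by rintro rfl; exact hu h
      omega
    rw [wres_wg, rfun_eq p v hu]
    rcases Nat.even_or_odd' v with ⟨k, rfl | rfl⟩
    · have e : (p : ℤ) ^ (2 * k) * u = u * (p ^ k) ^ 2 := by ring
      rw [e, wg_sq _ _ (pow_ne_zero _ hp0), if_neg (by simp), map_zero]
      symm
      exact (QuotientAddGroup.eq_zero_iff _).2 (LL_mem hu')
    · have e : (p : ℤ) ^ (2 * k + 1) * u = (p * u) * (p ^ k) ^ 2 := by ring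
      rw [e, wg_sq _ _ (pow_ne_zero _ hp0), if_pos (by simp)]
      simp only [wback, wlift_wg]
      exact keyC (Or.inr hu') rfl
  | zero => simp
  | add x y _ _ h1 h2 => rw [map_add, map_add, h1, h2, QuotientAddGroup.mk_add]
  | neg x _ h => rw [map_neg, map_neg, h, QuotientAddGroup.mk_neg]

theorem wsig_wg (a : ℤ) : wsig (wg a) = a.sign := wlift_wg _ _ _ _ a

theorem w_inj {x : WG ℤ} (hs : wsig x = 0) (hr : ∀ (p : ℕ) [Fact p.Prime], wres p x = 0) : x = 0 := by
  have h2 : ∀ k, x ∈ LL (k + 2) → x ∈ LL 2 := by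
    intro k
    induction k with
    | zero => exact id
    | succ k ih => 
      intro h
      apply ih
      by_cases hp : (k + 2).Prime
      · have : Fact (k + 2).Prime := ⟨hp⟩
        have := wback_wres (k + 2) (x := x) h
        rw [hr, map_zero] at this
        exact (QuotientAddGroup.eq_zero_iff _).1 this.symm
      · refine AddSubgroup.closure_mono ?_ h
        rintro y ⟨n, hn, rfl⟩
        refine ⟨n, ⟨hn.1, fun r hr h => ?_⟩, rfl⟩
        have h1 := hn.2 r hr h
        have h2 : r ≠ k + 2 := by rintro rfl; exact hp hr
        omega
  obtain ⟨k, hk⟩ := LL_exists x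
  have hx := h2 k (LL_mono (by omega) hk)
  have key : x = wsig x • wg 1 := by
    clear hs hr h2 hk
    induction hx using AddSubgroup.closure_induction with
    | mem x h =>
      obtain ⟨n, hn, rfl⟩ := h
      have : n.natAbs = 1 := by
        by_contra h1
        have := hn.2 _ (Nat.minFac_prime h1) (Int.natCast_dvd.2 (Nat.minFac_dvd _))
        have := (Nat.minFac_prime h1).two_le
        omega
      rcases Int.natAbs_eq_iff.1 this with h | h
      · rw [h, wsig_wg]; simp
      · rw [h, wsig_wg]; simp [wg_neg]
    | zero => simp
    | add x y _ _ h1 h2 => rw [map_add, add_zsmul, ← h1, ← h2]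
    | neg x _ h => rw [map_neg, neg_zsmul, ← h]
  rw [key, hs, zero_zsmul]

section
variable {p : ℕ} [hp : Fact p.Prime]

theorem wf_rep (h2 : p ≠ 2) {a b w : ZMod p} (ha : a ≠ 0) (hb : b ≠ 0) (hw : w ≠ 0) :
    wg a + wg b = wg w + wg (a * b * w) := by
  obtain ⟨x, y, hxy⟩ := FiniteField.exists_root_sum_quadratic
    (Polynomial.degree_quadratic (b := 0) (c := -w) ha) 
    (Polynomial.degree_quadratic (b := 0) (c := 0) hb)
    (by rw [ZMod.card]; exact hp.out.mod_two_eq_one_iff_ne_two.2 h2)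
  have hxy' : a * x ^ 2 + b * y ^ 2 = w := by
    simp at hxy
    linear_combination hxy
  by_cases hx : x = 0
  · have hy : y ≠ 0 := by rintro rfl; apply hw; rw [← hxy', hx]; simp
    have e : a * b * w = a * (b * y) ^ 2 := by rw [← hxy', hx]; ring
    rw [e, wg_sq _ _ (mul_ne_zero hb hy), ← hxy', hx]
    simp only [ne_eq, OfNat.ofNat_ne_zero, not_false_eq_true, zero_pow, mul_zero, zero_add]
    rw [wg_sq _ _ hy, add_comm]
  by_cases hy : y = 0
  · have e : a * b * w = b * (a * x) ^ 2 := by rw [← hxy', hy]; ring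
    rw [e, wg_sq _ _ (mul_ne_zero ha hx), ← hxy', hy]
    simp only [ne_eq, OfNat.ofNat_ne_zero, not_false_eq_true, zero_pow, mul_zero, add_zero]
    rw [wg_sq _ _ hx]
  have := wg_add (a * x ^ 2) (b * y ^ 2)
  rw [hxy', wg_sq _ _ hx, wg_sq _ _ hy] at this
  rw [this]
  have e : a * x ^ 2 * (b * y ^ 2) * w = (a * b * w) * (x * y) ^ 2 := by ring
  rw [e, wg_sq _ _ (mul_ne_zero hx hy)]

theorem wf_zero {a b : ZMod p} (ha : a ≠ 0) (hb : b ≠ 0) (h : IsSquare (-(a * b))) :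
    wg a + wg b = 0 := by
  obtain ⟨c, hc⟩ := h
  have hc0 : c ≠ 0 := by
    rintro rfl
    simp [ha, hb] at hc
  have e : b = (-a) * (c / a) ^ 2 := by
    field_simp
    linear_combination -hc
  rw [e, wg_sq _ _ (div_ne_zero hc0 ha), wg_neg, add_neg_cancel]

theorem wf_eq (h2 : p ≠ 2) {a b a' b' : ZMod p} (ha : a ≠ 0) (hb : b ≠ 0) 
    (h : ¬ IsSquare (-(a * b))) (ha' : a' ≠ 0) (hb' : b' ≠ 0) 
    (h' : ¬ IsSquare (-(a' * b'))) : wg a + wg b = wg a' + wg b' := by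
  have hsq : IsSquare (-(a * b) * -(a' * b')) := by
    classical
    rw [← quadraticChar_neg_one_iff_not_isSquare] at h h'
    rw [← quadraticChar_one_iff_isSquare, map_mul, h, h']
    · norm_num
    · simp [ha, hb, ha', hb']
  obtain ⟨c, hc⟩ := hsq
  have hc0 : c ≠ 0 := by
    rintro rfl
    simp [ha, hb, ha', hb'] at hc
  have e : a * b * a' = b' * (c / b') ^ 2 := by
    field_simp
    linear_combination hc
  rw [wf_rep h2 ha hb ha', e, wg_sq _ _ (div_ne_zero hc0 hb')]

theorem wf_class (h2 : p ≠ 2) (x : WG (ZMod p)) : x = 0 ∨ (∃ e, e ≠ 0 ∧ x = wg e) ∨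
    (∃ a b, a ≠ 0 ∧ b ≠ 0 ∧ ¬ IsSquare (-(a * b)) ∧ x = wg a + wg b) := by
  induction x using wg_induction with
  | h0 => left; rfl
  | h1 c x ih =>
    by_cases hc : c = 0
    · rw [hc, wg_zero, zero_add]; exact ih
    rcases ih with rfl | ⟨e, he, rfl⟩ | ⟨a, b, ha, hb, h, rfl⟩
    · right; left; exact ⟨c, hc, add_zero _⟩
    · by_cases hs : IsSquare (-(c * e))
      · left; exact wf_zero hc he hs
      · right; right; exact ⟨c, e, hc, he, hs, rfl⟩
    · right; left
      refine ⟨a * b * (-c), by simp [ha, hb, hc], ?_⟩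
      rw [wf_rep h2 ha hb (neg_ne_zero.2 hc), ← add_assoc, wg_neg, add_neg_cancel, zero_add]

theorem w2_class (x : WG (ZMod 2)) : x = 0 ∨ x = wg 1 := by
  induction x using wg_induction with
  | h0 => left; rfl
  | h1 c x ih =>
    have h11 : wg (1 : ZMod 2) + wg 1 = 0 := by
      have := wg_add (1 : ZMod 2) 1
      have e : (1 + 1 : ZMod 2) = 0 := rfl
      rwa [e, mul_zero, wg_zero, add_zero] at this
    have hc : c = 0 ∨ c = 1 := by revert c; decide
    rcases hc with rfl | rfl
    · rw [wg_zero, zero_add]; exact ih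
    · rcases ih with rfl | rfl
      · right; exact add_zero _
      · left; exact h11

theorem lemT (h2 : p ≠ 2) {A B : ℤ} (hA : ¬ (p : ℤ) ∣ A) (hB : ¬ (p : ℤ) ∣ B) 
    {a b : ZMod p} (ha : a ≠ 0) (hb : b ≠ 0) (h : ¬ IsSquare (-(a * b))) :
    ∃ c : ZMod p, c ≠ 0 ∧ ∀ q : ℤ, (q : ZMod p) = c → ∀ e : ℤ, ¬ (p : ℤ) ∣ e →
      wres p (wg (p * (A * q)) + wg (p * B) + wg (e * q)) = wg a + wg b := by
  obtain ⟨δ, hδ⟩ := FiniteField.exists_nonsquare (F := ZMod p) (by rwa [ZMod.ringChar_zmod_n])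
  have hδ0 : δ ≠ 0 := by rintro rfl; exact hδ (IsSquare.zero)
  have hA' := cast_ne hA
  have hB' := cast_ne hB
  have hc0 : -δ / (A * B : ZMod p) ≠ 0 := div_ne_zero (neg_ne_zero.2 hδ0) (mul_ne_zero hA' hB')
  refine ⟨-δ / (A * B), hc0, ?_⟩
  intro q hq e he
  have hqd : ¬ (p : ℤ) ∣ q := by
    rw [← ZMod.intCast_zmod_eq_zero_iff_dvd, hq]; exact hc0
  rw [map_add, map_add, wres_odd p (nd_mul hA hqd), wres_odd p hB, wres_unit p (nd_mul he hqd), 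
    add_zero]
  refine wf_eq h2 (cast_ne (nd_mul hA hqd)) hB' ?_ ha hb h
  have : -(((A * q : ℤ) : ZMod p) * B) = δ := by
    push_cast
    rw [hq]
    field_simp
  rwa [this]

theorem lemS {A : ℤ} (hA : ¬ (p : ℤ) ∣ A) {e : ZMod p} (he : e ≠ 0) :
    ∃ c : ZMod p, c ≠ 0 ∧ ∀ q : ℤ, (q : ZMod p) = c → ∀ B e' : ℤ, ¬ (p : ℤ) ∣ B → ¬ (p : ℤ) ∣ e' →
      wres p (wg (p * (A * q)) + wg B + wg (e' * q)) = wg e := by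
  have hA' := cast_ne hA
  have hc0 : e / (A : ZMod p) ≠ 0 := div_ne_zero he hA'
  refine ⟨e / A, hc0, ?_⟩
  intro q hq B e' hB he'
  have hqd : ¬ (p : ℤ) ∣ q := by
    rw [← ZMod.intCast_zmod_eq_zero_iff_dvd, hq]; exact hc0
  rw [map_add, map_add, wres_odd p (nd_mul hA hqd), wres_unit p hB, wres_unit p (nd_mul he' hqd), 
    add_zero, add_zero]
  congr 1
  push_cast
  rw [hq]
  field_simp

theorem nd_prod {T : Finset ℕ} (hT : ∀ r ∈ T, r.Prime) (hpT : p ∉ T) : ¬ (p : ℤ) ∣ ((∏ r ∈ T, r : ℕ) : ℤ) := by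
  rw [Int.natCast_dvd_natCast, (Nat.prime_iff.1 hp.out).dvd_finsetProd_iff]
  rintro ⟨r, hr, h⟩
  exact hpT (((Nat.prime_dvd_prime_iff_eq hp.out (hT r hr)).1 h) ▸ hr)

theorem nd_prime {r : ℕ} (hr : r.Prime) (h : p ≠ r) : ¬ (p : ℤ) ∣ r := by
  rw [Int.natCast_dvd_natCast]
  exact fun h' => h ((Nat.prime_dvd_prime_iff_eq hp.out hr).1 h')

theorem nd_sign {e : ℤ} (he : e = 1 ∨ e = -1) : ¬ (p : ℤ) ∣ e := by
  have : ¬ (p : ℤ) ∣ 1 := by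
    have := hp.out.one_lt
    intro h
    have := Int.le_of_dvd one_pos h
    omega
  rcases he with rfl | rfl
  · exact this
  · rwa [dvd_neg]
end

theorem exists_q (N c k : ℕ) (hN : Odd N) (hc : c.Coprime N) : ∃ q > k, q.Prime ∧ q ≡ c [MOD N] ∧ 
    q % 4 = 1 ∧ jacobiSym (2 * N) q = 1 := by
  have h8 : Nat.Coprime 8 N := by
    have : Nat.Coprime 2 N := Nat.coprime_two_left.2 hN
    exact Nat.Coprime.pow_left 3 this
  have hN0 : N ≠ 0 := by rintro rfl; simp at hN
  obtain ⟨j, hj⟩ : ∃ j : ℕ, (j = 1 ∧ jacobiSym c N = 1) ∨ (j = 5 ∧ jacobiSym c N = -1) := by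
    rcases jacobiSym.eq_one_or_neg_one (a := c) (b := N) (by simpa [Int.gcd_natCast_natCast] using hc) with h | h
    · exact ⟨1, Or.inl ⟨rfl, h⟩⟩
    · exact ⟨5, Or.inr ⟨rfl, h⟩⟩
  obtain ⟨d, hd1, hd2⟩ := Nat.chineseRemainder h8 j c
  have hd8 : d % 8 = j := by
    have : d % 8 = j % 8 := hd1
    rcases hj with h | h <;> omega
  have hdc : d.Coprime (8 * N) := by
    apply Nat.Coprime.mul_right
    · have : Nat.Coprime d 2 := Nat.coprime_two_right.2 (Nat.odd_iff.2 (by rcases hj with h | h <;> omega))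
      exact Nat.Coprime.pow_right 3 this
    · rw [Nat.Coprime, hd2.gcd_eq]; exact hc
  obtain ⟨q, hqk, hq, hqd⟩ := Nat.forall_exists_prime_gt_and_modEq k (by omega) hdc
  have hq8 : q % 8 = j := by
    have : q % 8 = d % 8 := hqd.of_mul_right N
    omega
  have hqN : q ≡ c [MOD N] := (hqd.of_mul_left 8).trans hd2
  have hq4 : q % 4 = 1 := by rcases hj with h | h <;> omega
  refine ⟨q, hqk, hq, hqN, hq4, ?_⟩
  have hqo : Odd q := Nat.odd_iff.2 (by omega)
  rw [jacobiSym.mul_left, jacobiSym.at_two hqo, jacobiSym.quadratic_reciprocity_one_mod_four' hN hq4,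
    jacobiSym.mod_left' (a₂ := c) (by exact_mod_cast hqN), ZMod.χ₈_nat_eq_if_mod_eight, if_neg (by omega)]
  rcases hj with ⟨h1, h2⟩ | ⟨h1, h2⟩
  · rw [if_pos (by omega), h2]; rfl
  · rw [if_neg (by omega), h2]; rfl

theorem zmod2_ne (y : ZMod 2) (h : y ≠ 0) : y = 1 := by revert y; decide

theorem ternary (x : WG ℤ) (hs : wsig x = 1 ∨ wsig x = -1 ∨ wsig x = 3 ∨ wsig x = -3) :
    ∃ u v w : ℤ, u ≠ 0 ∧ v ≠ 0 ∧ w ≠ 0 ∧ x = wg u + wg v + wg w := by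
  classical
  obtain ⟨e1, e2, e3, h1, h2, h3, hsum⟩ : ∃ e1 e2 e3 : ℤ, (e1 = 1 ∨ e1 = -1) ∧ (e2 = 1 ∨ e2 = -1) ∧
      (e3 = 1 ∨ e3 = -1) ∧ e1 + e2 + e3 = wsig x := by
    rcases hs with h | h | h | h <;> rw [h]
    · exact ⟨1, 1, -1, by simp⟩
    · exact ⟨-1, -1, 1, by simp⟩
    · exact ⟨1, 1, 1, by simp⟩
    · exact ⟨-1, -1, -1, by simp⟩
  obtain ⟨k, hk⟩ := LL_exists x
  have hzero : ∀ (p : ℕ) [Fact p.Prime], k ≤ p → wres p x = 0 := 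
    fun p _ h => wres_LL p (LL_mono h hk)
  obtain ⟨β, hβ⟩ : ∃ β : ℕ, (β = 1 ∧ wres 2 x = 0) ∨ (β = 0 ∧ wres 2 x = wg 1) := by
    rcases w2_class (wres 2 x) with h | h
    · exact ⟨1, Or.inl ⟨rfl, h⟩⟩
    · exact ⟨0, Or.inr ⟨rfl, h⟩⟩
  let S : Finset ℕ := (Finset.range k).filter (fun p => p ≠ 2 ∧ ∃ h : p.Prime, ∃ e, e ≠ 0 ∧ 
    @wres p ⟨h⟩ x = wg e)
  let T : Finset ℕ := (Finset.range k).filter (fun p => p ∉ S ∧ p ≠ 2 ∧ ∃ h : p.Prime, 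
    ∃ a b, a ≠ 0 ∧ b ≠ 0 ∧ ¬ IsSquare (-(a * b)) ∧ @wres p ⟨h⟩ x = wg a + wg b)
  have hSp : ∀ r ∈ S, r.Prime := fun r hr => (Finset.mem_filter.1 hr).2.2.1
  have hTp : ∀ r ∈ T, r.Prime := fun r hr => (Finset.mem_filter.1 hr).2.2.2.1
  have hS2 : 2 ∉ S := fun hr => (Finset.mem_filter.1 hr).2.1 rfl
  have hT2 : 2 ∉ T := fun hr => (Finset.mem_filter.1 hr).2.2.1 rfl
  have hTS : Disjoint T S := Finset.disjoint_left.2 fun r hr => (Finset.mem_filter.1 hr).2.1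
  obtain ⟨P, hP⟩ : ∃ P : ℕ, P = ∏ r ∈ T, r := ⟨_, rfl⟩
  obtain ⟨D, hD⟩ : ∃ D : ℕ, D = ∏ r ∈ S, r := ⟨_, rfl⟩
  have hPp : ∀ (p : ℕ) [Fact p.Prime], p ∉ T → ¬ (p : ℤ) ∣ P := fun p _ h => hP ▸ nd_prod hTp h
  have hDp : ∀ (p : ℕ) [Fact p.Prime], p ∉ S → ¬ (p : ℤ) ∣ D := fun p _ h => hD ▸ nd_prod hSp h
  have hPpos : 0 < P := hP ▸ Finset.prod_pos fun r hr => (hTp r hr).pos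
  have hDpos : 0 < D := hD ▸ Finset.prod_pos fun r hr => (hSp r hr).pos
  have hβp : ∀ (p : ℕ) [Fact p.Prime], p ≠ 2 → ¬ (p : ℤ) ∣ 2 ^ β := fun p hp h h' => 
    nd_prime Nat.prime_two h ((Nat.prime_iff_prime_int.1 hp.out).dvd_of_dvd_pow h')
  have h2p : ∀ (p : ℕ) [Fact p.Prime], p ≠ 2 → ¬ (p : ℤ) ∣ 2 := fun p hp h => 
    nd_prime Nat.prime_two h
  have hloc : ∀ p : ℕ, ∃ c : ℕ, p ∈ T ∪ S → ∃ hp : p.Prime, c.Coprime p ∧ ∀ q : ℕ, q ≡ c [MOD p] →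
      @wres p ⟨hp⟩ (wg (2 * e1 * (P * D) * q) + wg (e2 * 2 ^ β * P) + wg (e3 * q)) = @wres p ⟨hp⟩ x := by
    intro p
    by_cases hpT : p ∈ T
    · have hm := (Finset.mem_filter.1 hpT).2
      obtain ⟨hpS, hp2, hpp, a, b, ha, hb, hab, hx⟩ := hm
      have : Fact p.Prime := ⟨hpp⟩
      obtain ⟨P', hP'⟩ : ∃ P' : ℕ, P' = ∏ r ∈ T.erase p, r := ⟨_, rfl⟩
      have hPP : P = p * P' := by rw [hP, hP', Finset.mul_prod_erase T (fun r => r) hpT]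
      have hndP' : ¬ (p : ℤ) ∣ P' := hP' ▸ nd_prod (fun r hr => hTp r (Finset.mem_of_mem_erase hr)) 
        (Finset.notMem_erase p T)
      obtain ⟨c, hc0, hc⟩ := lemT hp2 (A := 2 * e1 * P' * D) (B := e2 * 2 ^ β * P')
        (nd_mul (nd_mul (nd_mul (h2p p hp2) (nd_sign h1)) hndP') (hDp p hpS))
        (nd_mul (nd_mul (nd_sign h2) (hβp p hp2)) hndP') ha hb hab
      refine ⟨c.val, fun _ => ⟨hpp, ?_, fun q hq => ?_⟩⟩
      · rw [Nat.coprime_comm, Nat.Prime.coprime_iff_not_dvd hpp, ← ZMod.natCast_eq_zero_iff]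
        simpa using hc0
      · have hq' : ((q : ℤ) : ZMod p) = c := by
          have := (ZMod.natCast_eq_natCast_iff _ _ _).2 hq
          simpa using this
        have := hc q hq' e3 (nd_sign h3)
        rw [hx, ← this, hPP]
        push_cast
        congr 4 <;> ring
    by_cases hpS : p ∈ S
    · have hm := (Finset.mem_filter.1 hpS).2
      obtain ⟨hp2, hpp, e, he, hx⟩ := hm
      have : Fact p.Prime := ⟨hpp⟩
      obtain ⟨P', hP'⟩ : ∃ P' : ℕ, P' = ∏ r ∈ S.erase p, r := ⟨_, rfl⟩
      have hPP : D = p * P' := by rw [hD, hP', Finset.mul_prod_erase S (fun r => r) hpS]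
      have hndP' : ¬ (p : ℤ) ∣ P' := hP' ▸ nd_prod (fun r hr => hSp r (Finset.mem_of_mem_erase hr)) 
        (Finset.notMem_erase p S)
      obtain ⟨c, hc0, hc⟩ := lemS (A := 2 * e1 * P * P')
        (nd_mul (nd_mul (nd_mul (h2p p hp2) (nd_sign h1)) (hPp p hpT)) hndP') he
      refine ⟨c.val, fun _ => ⟨hpp, ?_, fun q hq => ?_⟩⟩
      · rw [Nat.coprime_comm, Nat.Prime.coprime_iff_not_dvd hpp, ← ZMod.natCast_eq_zero_iff]
        simpa using hc0
      · have hq' : ((q : ℤ) : ZMod p) = c := by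
          have := (ZMod.natCast_eq_natCast_iff _ _ _).2 hq
          simpa using this
        have := hc q hq' (e2 * 2 ^ β * P) e3 
          (nd_mul (nd_mul (nd_sign h2) (hβp p hp2)) (hPp p hpT)) (nd_sign h3)
        rw [hx, ← this, hPP]
        push_cast
        congr 4
        ring
    · exact ⟨0, fun h => by simp [hpT, hpS] at h⟩
  choose c hc using hloc
  have hTSp : ∀ r ∈ T ∪ S, r.Prime := fun r hr => (Finset.mem_union.1 hr).elim (hTp r) (hSp r)
  obtain ⟨c0, hc0⟩ := Nat.chineseRemainderOfFinset c (fun p => p) (T ∪ S) 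
    (fun r hr => (hTSp r hr).ne_zero) (fun r hr s hs h => (Nat.coprime_primes (hTSp r hr) (hTSp s hs)).2 h)
  have hN : P * D = ∏ r ∈ T ∪ S, r := by rw [Finset.prod_union hTS, hP, hD]
  have hcop : c0.Coprime (P * D) := by
    rw [hN]
    apply Nat.Coprime.prod_right
    intro r hr
    rw [Nat.Coprime, (hc0 r hr).gcd_eq]
    exact (hc r hr).2.1
  have hodd : Odd (P * D) := by
    rw [← Nat.not_even_iff_odd, even_iff_two_dvd]
    have := nd_mul (hPp 2 hT2) (hDp 2 hS2)
    exact_mod_cast this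
  obtain ⟨q, hqk, hq, hqc, hq4, hqJ⟩ := exists_q (P * D) c0 (k + 2 + P * D) hodd hcop
  have hqpos := hq.pos
  have hq2 : q ≠ 2 := by omega
  have hqS : q ∉ S := fun h => by have := Finset.mem_range.1 (Finset.mem_filter.1 h).1; omega
  have hqT : q ∉ T := fun h => by have := Finset.mem_range.1 (Finset.mem_filter.1 h).1; omega
  have hsn : ∀ e : ℤ, (e = 1 ∨ e = -1) → e ≠ 0 := by rintro e (rfl | rfl) <;> norm_num
  refine ⟨2 * e1 * (P * D) * q, e2 * 2 ^ β * P, e3 * q, ?_, ?_, ?_, ?_⟩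
  · have := hsn e1 h1; positivity
  · have := hsn e2 h2; positivity
  · have := hsn e3 h3; positivity
  rw [← sub_eq_zero]
  apply w_inj
  · rw [map_sub, map_add, map_add, wsig_wg, wsig_wg, wsig_wg, ← hsum]
    have s1 : ∀ e n : ℤ, (e = 1 ∨ e = -1) → 0 < n → (e * n).sign = e := by
      rintro e n (rfl | rfl) hn
      · simpa using hn
      · simpa using hn
    have r1 : (2 * e1 * (P * D) * q).sign = e1 := by
      have := s1 e1 (2 * (P * D) * q) h1 (by positivity)
      have e : 2 * e1 * (P * D) * q = e1 * (2 * (P * D) * q) := by ring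
      rw [e, this]
    have r2 : (e2 * 2 ^ β * P).sign = e2 := by
      rw [mul_assoc]; exact s1 e2 _ h2 (by positivity)
    rw [r1, r2, s1 e3 _ h3 (by positivity), sub_self]
  · intro p hp
    rw [map_sub, sub_eq_zero, eq_comm]
    by_cases hpTS : p ∈ T ∪ S
    · refine (hc p hpTS).2.2 q ?_
      refine (hqc.of_dvd ?_).trans (hc0 p hpTS)
      rw [hN]
      exact Finset.dvd_prod_of_mem _ hpTS
    rw [Finset.mem_union, not_or] at hpTS
    obtain ⟨hpT, hpS⟩ := hpTS
    have nP := hPp p hpT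
    have nD := hDp p hpS
    by_cases hpq : p = q
    · subst hpq
      rw [hzero p (by omega), map_add, map_add, wres_unit p (nd_mul (nd_mul (nd_sign h2) (hβp p hq2)) nP)]
      have n1 := nd_mul (nd_mul (h2p p hq2) (nd_sign h1)) (nd_mul nP nD)
      rw [mul_comm _ (p : ℤ), mul_comm _ (p : ℤ), wres_odd p n1, wres_odd p (nd_sign h3), add_zero]
      refine wf_zero (cast_ne n1) (cast_ne (nd_sign h3)) ?_
      have : jacobiSym (-(2 * e1 * (P * D) * e3)) p = 1 := by
        have hm : jacobiSym (-1) p = 1 := by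
          rw [jacobiSym.at_neg_one (Nat.odd_iff.2 (by omega)), ZMod.χ₄_nat_one_mod_four hq4]
        have hj : ∀ e : ℤ, (e = 1 ∨ e = -1) → jacobiSym e p = 1 := by
          rintro e (rfl | rfl)
          · exact jacobiSym.one_left _
          · exact hm
        have e : -(2 * e1 * (P * D) * e3) = (-1) * e1 * e3 * (2 * (P * D : ℕ)) := by push_cast; ring
        rw [e, jacobiSym.mul_left, jacobiSym.mul_left, jacobiSym.mul_left, hm, hj _ h1, hj _ h3, hqJ]
        rfl
      have := ZMod.isSquare_of_jacobiSym_eq_one this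
      push_cast at this ⊢
      exact this
    have nq : ¬ (p : ℤ) ∣ q := nd_prime hq hpq
    by_cases hp2 : p = 2
    · subst hp2
      have n1 := nd_mul (nd_mul (nd_sign (p := 2) h1) (nd_mul nP nD)) nq
      have cast1 : ∀ n : ℤ, ¬ ((2 : ℕ) : ℤ) ∣ n → (n : ZMod 2) = 1 := by
        intro n hn
        exact zmod2_ne _ (cast_ne hn)
      have e : 2 * e1 * (P * D) * q = (2 : ℕ) * (e1 * (P * D) * q) := by push_cast; ring
      rw [map_add, map_add, e, wres_odd 2 n1, cast1 _ n1, wres_unit 2 (nd_mul (nd_sign h3) nq), add_zero]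
      have n2 := nd_mul (nd_sign (p := 2) h2) nP
      rcases hβ with ⟨rfl, hx⟩ | ⟨rfl, hx⟩
      · have e : e2 * 2 ^ 1 * P = (2 : ℕ) * (e2 * P) := by push_cast; ring
        rw [hx, e, wres_odd 2 n2, cast1 _ n2]
        have := wg_add (1 : ZMod 2) 1
        have e : (1 + 1 : ZMod 2) = 0 := rfl
        rwa [e, mul_zero, wg_zero, add_zero] at this
      · rw [hx, pow_zero, mul_one, wres_unit 2 n2, add_zero]
    · have hx : wres p x = 0 := by
        by_cases hpk : k ≤ p
        · exact hzero p hpk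
        have hpk' : p ∈ Finset.range k := Finset.mem_range.2 (by omega)
        rcases wf_class hp2 (wres p x) with h | h | h
        · exact h
        · exact absurd (Finset.mem_filter.2 ⟨hpk', hp2, hp.out, h⟩) hpS
        · exact absurd (Finset.mem_filter.2 ⟨hpk', hpS, hp2, hp.out, h⟩) hpT
      rw [hx, map_add, map_add, wres_unit p (nd_mul (nd_mul (nd_sign h2) (hβp p hp2)) nP),
        wres_unit p (nd_mul (nd_sign h3) nq), 
        wres_unit p (nd_mul (nd_mul (nd_mul (h2p p hp2) (nd_sign h1)) (nd_mul nP nD)) nq), 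
        add_zero, add_zero]

/-- Diagonal form with at least half-dimensional isotropic subspace. -/
def HypF {ι : Type} [Fintype ι] (w : ι → ℚ) : Prop :=
  ∃ N : Submodule ℚ (ι → ℚ), (∀ x ∈ N, ∀ y ∈ N, ∑ i, w i * x i * y i = 0) ∧
    Fintype.card ι ≤ 2 * Module.finrank ℚ N

theorem fr_map {V W : Type} [AddCommGroup V] [AddCommGroup W] [Module ℚ V] [Module ℚ W]
    {T : V →ₗ[ℚ] W} (hT : Function.Injective T) (N : Submodule ℚ V) :
    Module.finrank ℚ (N.map T) = Module.finrank ℚ N :=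
  (Submodule.equivMapOfInjective T hT N).finrank_eq.symm

section
variable {ι κ : Type} [Fintype ι] [Fintype κ]

theorem HypF.map {w : ι → ℚ} {z : κ → ℚ} (T : (ι → ℚ) →ₗ[ℚ] (κ → ℚ))
    (hT : Function.Injective T)
    (h : ∀ x y, ∑ i, z i * T x i * T y i = ∑ i, w i * x i * y i)
    (hc : Fintype.card κ ≤ Fintype.card ι) (hw : HypF w) : HypF z := by
  obtain ⟨N, h1, h2⟩ := hw
  refine ⟨N.map T, ?_, ?_⟩
  · rintro _ ⟨x, hx, rfl⟩ _ ⟨y, hy, rfl⟩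
    rw [h, h1 x hx y hy]
  · rw [fr_map hT]
    omega

theorem HypF.congr {w : ι → ℚ} {z : κ → ℚ} (e : ι ≃ κ) (h : ∀ i, z (e i) = w i)
    (hw : HypF w) : HypF z := by
  refine hw.map (LinearEquiv.funCongrLeft ℚ ℚ e.symm).toLinearMap
    (LinearEquiv.injective _) ?_ (Fintype.card_congr e).ge
  intro x y
  rw [← e.sum_comp]
  simp [h, LinearEquiv.funCongrLeft, LinearMap.funLeft]

theorem HypF.neg {w : ι → ℚ} (hw : HypF w) : HypF (-w) := by
  obtain ⟨N, h1, h2⟩ := hw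
  refine ⟨N, fun x hx y hy => ?_, h2⟩
  simpa using h1 x hx y hy

theorem HypF.sum {w : ι → ℚ} {z : κ → ℚ} (hw : HypF w) (hz : HypF z) : HypF (Sum.elim w z) := by
  obtain ⟨N, h1, h2⟩ := hw
  obtain ⟨M, h3, h4⟩ := hz
  let T : (N × M) →ₗ[ℚ] (ι ⊕ κ → ℚ) :=
    { toFun := fun x => Sum.elim x.1.1 x.2.1
      map_add' := by intro x y; ext (i | i) <;> simp
      map_smul' := by intro x y; ext (i | i) <;> simp }
  have hT : Function.Injective T := by
    rintro ⟨⟨x, _⟩, ⟨y, _⟩⟩ ⟨⟨x', _⟩, ⟨y', _⟩⟩ h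
    have a1 : x = x' := funext fun i => congrFun h (Sum.inl i)
    have a2 : y = y' := funext fun i => congrFun h (Sum.inr i)
    subst a1 a2
    rfl
  refine ⟨LinearMap.range T, ?_, ?_⟩
  · rintro _ ⟨x, rfl⟩ _ ⟨y, rfl⟩
    simp [T, h1 _ x.1.2 _ y.1.2, h3 _ x.2.2 _ y.2.2]
  · rw [LinearMap.finrank_range_of_inj hT, Fintype.card_sum, Module.finrank_prod]
    omega

theorem HypF.diag (w : ι → ℚ) : HypF (Sum.elim w (-w)) := by
  let T : (ι → ℚ) →ₗ[ℚ] (ι ⊕ ι → ℚ) :=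
    { toFun := fun x => Sum.elim x x
      map_add' := by intro x y; ext (i | i) <;> simp
      map_smul' := by intro x y; ext (i | i) <;> simp }
  have hT : Function.Injective T := by
    intro x y h
    ext i
    exact congrFun h (Sum.inl i)
  refine ⟨LinearMap.range T, ?_, ?_⟩
  · rintro _ ⟨x, rfl⟩ _ ⟨y, rfl⟩
    simp [T]
  · rw [LinearMap.finrank_range_of_inj hT]
    simp [two_mul]

theorem perp_dim {w : ι → ℚ} (hw : ∀ i, w i ≠ 0) (A B : Submodule ℚ (ι → ℚ))
    (h : ∀ x ∈ A, ∀ y ∈ B, ∑ i, w i * x i * y i = 0) :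
    Module.finrank ℚ A + Module.finrank ℚ B ≤ Fintype.card ι := by
  classical
  let T : (ι → ℚ) →ₗ[ℚ] Module.Dual ℚ (ι → ℚ) :=
    LinearMap.mk₂ ℚ (fun x y => ∑ i, w i * x i * y i)
      (by intros; simp [mul_add, add_mul, Finset.sum_add_distrib])
      (by intros; simp [Finset.mul_sum]; congr 1; ext; ring)
      (by intros; simp [mul_add, add_mul, Finset.sum_add_distrib])
      (by intros; simp [Finset.mul_sum]; congr 1; ext; ring)
  have hT : Function.Injective T := by
    rw [injective_iff_map_eq_zero]
    intro x hx
    ext i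
    have := LinearMap.congr_fun hx (Pi.single i 1)
    simpa [T, Pi.single_apply, hw i] using this
  have h1 : A.map T ≤ B.dualAnnihilator := by
    rintro _ ⟨x, hx, rfl⟩
    rw [Submodule.mem_dualAnnihilator]
    exact fun y hy => h x hx y hy
  have h2 := Submodule.finrank_mono h1
  rw [fr_map hT] at h2
  have h3 := Subspace.finrank_add_finrank_dualAnnihilator_eq B
  rw [Module.finrank_fintype_fun_eq_card] at h3
  omega

theorem HypF.cancel {w : ι → ℚ} {z : κ → ℚ} (hw0 : ∀ i, w i ≠ 0) (hz0 : ∀ i, z i ≠ 0)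
    (h : HypF (Sum.elim w z)) (hz : HypF z) : HypF w := by
  obtain ⟨N, hN, hN2⟩ := h
  obtain ⟨L, hL, hL2⟩ := hz
  let pl : (ι ⊕ κ → ℚ) →ₗ[ℚ] (ι → ℚ) := LinearMap.funLeft ℚ ℚ Sum.inl
  let pr : (ι ⊕ κ → ℚ) →ₗ[ℚ] (κ → ℚ) := LinearMap.funLeft ℚ ℚ Sum.inr
  have hpr : LinearMap.range pr = ⊤ := by
    rw [LinearMap.range_eq_top]
    exact LinearMap.funLeft_surjective_of_injective _ _ _ Sum.inr_injective
  have hB : ∀ x y, ∑ i, Sum.elim w z i * x i * y i =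
      ∑ i, w i * pl x i * pl y i + ∑ i, z i * pr x i * pr y i := by
    intro x y
    simp [pl, pr, LinearMap.funLeft]
  let S' := L.comap pr
  let S := S' ⊓ LinearMap.ker pl
  have dS' : Module.finrank ℚ S' = Fintype.card ι + Module.finrank ℚ L := by
    have a1 := LinearMap.finrank_range_add_finrank_ker (pr.domRestrict S')
    have a2 := LinearMap.finrank_range_add_finrank_ker pr
    rw [hpr, finrank_top] at a2
    simp only [Module.finrank_fintype_fun_eq_card, Fintype.card_sum] at a2
    have a3 : LinearMap.range (pr.domRestrict S') = L := by
      rw [LinearMap.range_domRestrict, Submodule.map_comap_eq, hpr, top_inf_eq]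
    have a4 : Module.finrank ℚ (LinearMap.ker (pr.domRestrict S')) =
        Module.finrank ℚ (LinearMap.ker pr) := by
      have : (LinearMap.ker (pr.domRestrict S')).map S'.subtype = LinearMap.ker pr := by
        ext x
        simp only [Submodule.mem_map, LinearMap.mem_ker]
        constructor
        · rintro ⟨y, hy, rfl⟩; exact hy
        · intro hx
          refine ⟨⟨x, ?_⟩, hx, rfl⟩
          change pr x ∈ L
          rw [hx]; exact zero_mem _
      rw [← this, fr_map (Submodule.injective_subtype _)]
    rw [a3] at a1
    omega
  have hperp := perp_dim (w := Sum.elim w z) (by rintro (i | i) <;> simp [hw0, hz0])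
    (N ⊓ S) (N ⊔ S') (by
      rintro x ⟨hx1, hx2, hx3⟩ y hy
      obtain ⟨a, ha, b, hb, rfl⟩ := Submodule.mem_sup.1 hy
      have e1 := hN x hx1 a ha
      have e2 : ∑ i, Sum.elim w z i * x i * b i = 0 := by
        rw [hB, hL _ hx2 _ hb, LinearMap.mem_ker.1 hx3]
        simp
      simp only [Pi.add_apply, mul_add, Finset.sum_add_distrib, e1, e2, add_zero])
  have hsup := Submodule.finrank_sup_add_finrank_inf_eq N S'
  refine ⟨(N ⊓ S').map pl, ?_, ?_⟩
  · rintro _ ⟨x, hx, rfl⟩ _ ⟨y, hy, rfl⟩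
    have e1 := hN x hx.1 y hy.1
    rw [hB, hL _ hx.2 _ hy.2, add_zero] at e1
    exact e1
  · have a1 := LinearMap.finrank_range_add_finrank_ker (pl.domRestrict (N ⊓ S'))
    rw [LinearMap.range_domRestrict] at a1
    have a4 : Module.finrank ℚ (LinearMap.ker (pl.domRestrict (N ⊓ S'))) =
        Module.finrank ℚ (N ⊓ S : Submodule ℚ (ι ⊕ κ → ℚ)) := by
      have : (LinearMap.ker (pl.domRestrict (N ⊓ S'))).map (N ⊓ S').subtype = N ⊓ S := by
        ext x
        simp only [Submodule.mem_map, LinearMap.mem_ker]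
        constructor
        · rintro ⟨y, hy, rfl⟩; exact ⟨y.2.1, y.2.2, hy⟩
        · rintro ⟨hx1, hx2, hx3⟩
          exact ⟨⟨x, hx1, hx2⟩, hx3, rfl⟩
      rw [← this, fr_map (Submodule.injective_subtype _)]
    rw [Fintype.card_sum] at hperp hN2
    omega
end

/-- Nondegenerate diagonal forms. -/
structure QF : Type 1 where
  ι : Type
  ft : Fintype ι
  w : ι → ℚ
  nz : ∀ i, w i ≠ 0

attribute [instance] QF.ft

/-- Witt equivalence. -/
def QF.r (a b : QF) : Prop := HypF (Sum.elim a.w (-b.w))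

/-- Sum of forms. -/
def QF.add (a b : QF) : QF := ⟨a.ι ⊕ b.ι, inferInstance, Sum.elim a.w b.w, by
  rintro (i | i) <;> simp [a.nz, b.nz]⟩

/-- Negative of a form. -/
def QF.neg (a : QF) : QF := ⟨a.ι, inferInstance, -a.w, by simp [a.nz]⟩

/-- The zero form. -/
def QF.zero : QF := ⟨Empty, inferInstance, fun _ => 1, by simp⟩

/-- One dimensional forms. -/
def QF.one (c : ℚ) (hc : c ≠ 0) : QF := ⟨Unit, inferInstance, fun _ => c, by simp [hc]⟩

theorem QF.r_refl (a : QF) : a.r a := HypF.diag a.w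

theorem QF.r_of_equiv {a b : QF} (e : a.ι ≃ b.ι) (h : ∀ i, b.w (e i) = a.w i) : a.r b :=
  HypF.congr (Equiv.sumCongr (Equiv.refl _) e) (by rintro (i | i) <;> simp [h]) a.r_refl

theorem QF.r_symm {a b : QF} (h : a.r b) : b.r a :=
  HypF.congr (Equiv.sumComm _ _) (by rintro (i | i) <;> simp) (HypF.neg h)

theorem QF.r_trans {a b c : QF} (h : a.r b) (h' : b.r c) : a.r c := by
  refine HypF.cancel (z := Sum.elim b.w (-b.w)) ?_ ?_ ?_ (HypF.diag b.w)
  · rintro (i | i) <;> simp [a.nz, c.nz]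
  · rintro (i | i) <;> simp [b.nz]
  · refine HypF.congr ((Equiv.sumCongr (Equiv.refl _) (Equiv.sumComm _ _)).trans
      ((Equiv.sumSumSumComm _ _ _ _).trans
        (Equiv.sumCongr (Equiv.refl _) (Equiv.sumComm _ _)))) ?_ (HypF.sum h h')
    rintro ((i | i) | (i | i)) <;> simp

theorem QF.r_add {a b c d : QF} (h : a.r b) (h' : c.r d) : (a.add c).r (b.add d) := by
  refine HypF.congr (Equiv.sumSumSumComm _ _ _ _) ?_ (HypF.sum h h')
  rintro ((i | i) | (i | i)) <;> rfl

theorem QF.r_neg {a b : QF} (h : a.r b) : a.neg.r b.neg := by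
  refine HypF.congr (Equiv.refl _) ?_ (HypF.neg h)
  rintro (i | i) <;> rfl

theorem QF.r_neg_add (a : QF) : (a.neg.add a).r QF.zero := by
  refine HypF.congr ((Equiv.sumComm _ _).trans (Equiv.sumEmpty _ Empty).symm) ?_ (HypF.diag a.w)
  rintro (i | i) <;> rfl

/-- The setoid. -/
def QF.st : Setoid QF := ⟨QF.r, QF.r_refl, QF.r_symm, QF.r_trans⟩

/-- The Witt group of diagonal forms. -/
def WQ : Type 1 := Quotient QF.st

/-- Class of a form. -/
def QF.cl (a : QF) : WQ := Quotient.mk QF.st a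

theorem QF.cl_eq {a b : QF} : a.cl = b.cl ↔ a.r b := by
  unfold QF.cl
  exact Quotient.eq (r := QF.st)

theorem WQ.ind {P : WQ → Prop} (h : ∀ a : QF, P a.cl) (x : WQ) : P x := Quotient.ind h x

instance : Add WQ := ⟨Quotient.map₂ QF.add (fun _ _ h _ _ h' => QF.r_add h h')⟩
instance : Neg WQ := ⟨Quotient.map QF.neg (fun _ _ h => QF.r_neg h)⟩
instance : Zero WQ := ⟨QF.zero.cl⟩

theorem QF.cl_add (a b : QF) : a.cl + b.cl = (a.add b).cl := rfl
theorem QF.cl_neg (a : QF) : -a.cl = a.neg.cl := rfl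
theorem QF.cl_zero : (0 : WQ) = QF.zero.cl := rfl

theorem WQ.add_comm (x y : WQ) : x + y = y + x := by
  induction x using WQ.ind
  induction y using WQ.ind
  rw [QF.cl_add, QF.cl_add, QF.cl_eq]
  refine QF.r_of_equiv (Equiv.sumComm _ _) ?_
  rintro (i | i) <;> rfl

theorem WQ.zero_add (x : WQ) : 0 + x = x := by
  induction x using WQ.ind
  rw [QF.cl_zero, QF.cl_add, QF.cl_eq]
  refine QF.r_of_equiv (Equiv.emptySum Empty _) ?_
  rintro (i | i)
  · exact i.elim
  · rfl

instance : AddCommGroup WQ where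
  add_assoc x y z := by
    induction x using WQ.ind
    induction y using WQ.ind
    induction z using WQ.ind
    simp only [QF.cl_add]
    rw [QF.cl_eq]
    refine QF.r_of_equiv (Equiv.sumAssoc _ _ _) ?_
    rintro ((i | i) | i) <;> rfl
  zero_add := WQ.zero_add
  add_zero x := by rw [WQ.add_comm, WQ.zero_add]
  add_comm := WQ.add_comm
  neg_add_cancel x := by
    induction x using WQ.ind
    rw [QF.cl_neg, QF.cl_add, QF.cl_zero, QF.cl_eq]
    exact QF.r_neg_add _
  nsmul := nsmulRec
  zsmul := zsmulRec

theorem hyp4 (a b c d : ℚ) (hc : c = a + b) (hd : d = a * b * (a + b)) :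
    HypF (Sum.elim (Sum.elim (fun _ : Unit => a) (fun _ : Unit => b))
    (-(Sum.elim (fun _ : Unit => c) (fun _ : Unit => d)))) := by
  subst hc hd
  let T : (ℚ × ℚ) →ₗ[ℚ] ((Unit ⊕ Unit) ⊕ (Unit ⊕ Unit) → ℚ) :=
    { toFun := fun x => Sum.elim (Sum.elim (fun _ => x.1 + x.2 * b) (fun _ => x.1 - x.2 * a))
        (Sum.elim (fun _ => x.1) (fun _ => x.2))
      map_add' := by intro x y; ext ((i | i) | (i | i)) <;> simp <;> ring
      map_smul' := by intro x y; ext ((i | i) | (i | i)) <;> simp <;> ring }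
  have hT : Function.Injective T := by
    intro x y h
    exact Prod.ext (congrFun h (Sum.inr (Sum.inl ()))) (congrFun h (Sum.inr (Sum.inr ())))
  refine ⟨LinearMap.range T, ?_, ?_⟩
  · rintro _ ⟨x, rfl⟩ _ ⟨y, rfl⟩
    simp [T]
    ring
  · rw [LinearMap.finrank_range_of_inj hT]
    simp

theorem hyp2 (a c d : ℚ) (hd : d = a * c ^ 2) :
    HypF (Sum.elim (fun _ : Unit => d) (-(fun _ : Unit => a))) := by
  subst hd
  let T : ℚ →ₗ[ℚ] (Unit ⊕ Unit → ℚ) :=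
    { toFun := fun x => Sum.elim (fun _ => x) (fun _ => c * x)
      map_add' := by intro x y; ext (i | i) <;> simp <;> ring
      map_smul' := by intro x y; ext (i | i) <;> simp <;> ring }
  have hT : Function.Injective T := by
    intro x y h
    exact congrFun h (Sum.inl ())
  refine ⟨LinearMap.range T, ?_, ?_⟩
  · rintro _ ⟨x, rfl⟩ _ ⟨y, rfl⟩
    simp [T]
    ring
  · rw [LinearMap.finrank_range_of_inj hT]
    simp

open Classical in
/-- The class of a one dimensional form, or zero. -/
noncomputable def cl1 (a : ℤ) : WQ :=
  if h : (a : ℚ) = 0 then 0 else (QF.one a h).cl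

theorem cl1_zero : cl1 0 = 0 := by simp [cl1]

theorem cl1_nz {a : ℤ} (h : (a : ℚ) ≠ 0) : cl1 a = (QF.one a h).cl := by simp [cl1, h]

/-- The map to the Witt group. -/
noncomputable def toWQ : WG ℤ →+ WQ := wlift cl1 cl1_zero
  (by
    intro a b
    by_cases ha : (a : ℚ) = 0
    · have : a = 0 := by exact_mod_cast ha
      subst this; simp [cl1_zero]
    by_cases hb : (b : ℚ) = 0
    · have : b = 0 := by exact_mod_cast hb
      subst this; simp [cl1_zero]
    by_cases hab : ((a + b : ℤ) : ℚ) = 0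
    · have h1 : a + b = 0 := by exact_mod_cast hab
      rw [h1, mul_zero, cl1_zero, cl1_nz ha, cl1_nz hb, QF.cl_add, add_zero, QF.cl_zero, QF.cl_eq]
      refine QF.r_trans (QF.r_of_equiv (Equiv.sumComm _ _) ?_) (QF.r_neg_add (QF.one a ha))
      have h2 : (a : ℚ) + b = 0 := by exact_mod_cast h1
      rintro (i | i)
      · rfl
      · change -(a : ℚ) = b
        linarith
    · have h3 : ((a * b * (a + b) : ℤ) : ℚ) ≠ 0 := by
        push_cast at hab ⊢
        exact mul_ne_zero (mul_ne_zero ha hb) hab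
      rw [cl1_nz ha, cl1_nz hb, cl1_nz hab, cl1_nz h3, QF.cl_add, QF.cl_add, QF.cl_eq]
      exact hyp4 a b ((a + b : ℤ) : ℚ) ((a * b * (a + b) : ℤ) : ℚ) (by push_cast; rfl) (by push_cast; rfl))
  (by
    intro a c hc
    by_cases ha : (a : ℚ) = 0
    · have : a = 0 := by exact_mod_cast ha
      subst this; simp [cl1_zero]
    have hc' : (c : ℚ) ≠ 0 := by exact_mod_cast hc
    have h3 : ((a * c ^ 2 : ℤ) : ℚ) ≠ 0 := by
      push_cast
      exact mul_ne_zero ha (pow_ne_zero _ hc')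
    rw [cl1_nz ha, cl1_nz h3, QF.cl_eq]
    exact hyp2 a c ((a * c ^ 2 : ℤ) : ℚ) (by push_cast; rfl))

theorem toWQ_wg {a : ℤ} (h : (a : ℚ) ≠ 0) : toWQ (wg a) = (QF.one a h).cl := by
  rw [toWQ, wlift_wg, cl1_nz h]

theorem five_of_three {a b c d e u v w : ℤ} (ha : a ≠ 0) (hb : b ≠ 0) (hc : c ≠ 0) (hd : d ≠ 0)
    (he : e ≠ 0) (hu : u ≠ 0) (hv : v ≠ 0) (hw : w ≠ 0)
    (h : wg a + wg b + wg c + wg d + wg e = wg u + wg v + wg w) :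
    ∃ p q r s t : ℚ, ¬ (p = 0 ∧ q = 0 ∧ r = 0 ∧ s = 0 ∧ t = 0) ∧
      a * p ^ 2 + b * q ^ 2 + c * r ^ 2 + d * s ^ 2 + e * t ^ 2 = 0 := by
  have cz : ∀ {x : ℤ}, x ≠ 0 → (x : ℚ) ≠ 0 := by intro x hx; exact_mod_cast hx
  have h2 := congrArg toWQ h
  simp only [map_add] at h2
  rw [toWQ_wg (cz ha), toWQ_wg (cz hb), toWQ_wg (cz hc), toWQ_wg (cz hd), toWQ_wg (cz he),
    toWQ_wg (cz hu), toWQ_wg (cz hv), toWQ_wg (cz hw)] at h2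
  simp only [QF.cl_add] at h2
  rw [QF.cl_eq] at h2
  have h3 : HypF (ι := ((((Unit ⊕ Unit) ⊕ Unit) ⊕ Unit) ⊕ Unit) ⊕ ((Unit ⊕ Unit) ⊕ Unit))
      (Sum.elim (Sum.elim (Sum.elim (Sum.elim (Sum.elim (fun _ => (a : ℚ)) (fun _ => (b : ℚ)))
        (fun _ => (c : ℚ))) (fun _ => (d : ℚ))) (fun _ => (e : ℚ)))
        (-(Sum.elim (Sum.elim (fun _ => (u : ℚ)) (fun _ => (v : ℚ))) (fun _ => (w : ℚ))))) := h2
  obtain ⟨N, hN, hN2⟩ := h3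
  have hcard : 4 ≤ Module.finrank ℚ N := by
    simp at hN2
    omega
  let T : N →ₗ[ℚ] ((Unit ⊕ Unit) ⊕ Unit → ℚ) := (LinearMap.funLeft ℚ ℚ Sum.inr).domRestrict N
  have hk : LinearMap.ker T ≠ ⊥ := by
    apply LinearMap.ker_ne_bot_of_finrank_lt
    rw [Module.finrank_fintype_fun_eq_card]
    simp
    omega
  obtain ⟨⟨x, hx⟩, hxT, hx0⟩ := (Submodule.ne_bot_iff _).1 hk
  have hxr : ∀ i, x (Sum.inr i) = 0 := fun i => congrFun hxT i
  have hB := hN x hx x hx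
  refine ⟨x (Sum.inl (Sum.inl (Sum.inl (Sum.inl (Sum.inl ()))))),
    x (Sum.inl (Sum.inl (Sum.inl (Sum.inl (Sum.inr ()))))),
    x (Sum.inl (Sum.inl (Sum.inl (Sum.inr ())))),
    x (Sum.inl (Sum.inl (Sum.inr ()))), x (Sum.inl (Sum.inr ())), ?_, ?_⟩
  · rintro ⟨h1, h2, h3, h4, h5⟩
    apply hx0
    ext i
    rcases i with ((((i | i) | i) | i) | i) | i
    · exact h1
    · exact h2
    · exact h3
    · exact h4
    · exact h5
    · exact hxr i
  · simp [Fintype.sum_sum_type] at hB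
    have e1 := hxr (Sum.inl (Sum.inl ()))
    have e2 := hxr (Sum.inl (Sum.inr ()))
    have e3 := hxr (Sum.inr ())
    rw [e1, e2, e3] at hB
    linarith

theorem rat_int (a : ℚ) (ha : a ≠ 0) : ∃ (A : ℤ) (k : ℚ), A ≠ 0 ∧ k ≠ 0 ∧ (A : ℚ) = a * k ^ 2 := by
  refine ⟨a.num * a.den, a.den, ?_, ?_, ?_⟩
  · simpa using ha
  · simp
  · have : a * a.den = a.num := Rat.mul_den_eq_num a
    push_cast
    rw [← this]; ring

theorem five_iso {a b c d e : ℚ} (ha : 0 < a) (hb : b < 0) (hc : c ≠ 0) (hd : d ≠ 0) (he : e ≠ 0) :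
    ∃ p q r s t : ℚ, ¬ (p = 0 ∧ q = 0 ∧ r = 0 ∧ s = 0 ∧ t = 0) ∧
      a * p ^ 2 + b * q ^ 2 + c * r ^ 2 + d * s ^ 2 + e * t ^ 2 = 0 := by
  obtain ⟨A, ka, hA, hka, eA⟩ := rat_int a ha.ne'
  obtain ⟨B, kb, hB, hkb, eB⟩ := rat_int b hb.ne
  obtain ⟨C, kc, hC, hkc, eC⟩ := rat_int c hc
  obtain ⟨D, kd, hD, hkd, eD⟩ := rat_int d hd
  obtain ⟨E, ke, hE, hke, eE⟩ := rat_int e he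
  have hA1 : A.sign = 1 := by
    apply Int.sign_eq_one_of_pos
    have : (0 : ℚ) < A := by rw [eA]; positivity
    exact_mod_cast this
  have hB1 : B.sign = -1 := by
    apply Int.sign_eq_neg_one_of_neg
    have : (B : ℚ) < 0 := by rw [eB]; exact mul_neg_of_neg_of_pos hb (by positivity)
    exact_mod_cast this
  have hs : ∀ x : ℤ, x ≠ 0 → x.sign = 1 ∨ x.sign = -1 := by
    intro x hx
    rcases lt_or_gt_of_ne hx with h | h
    · exact Or.inr (Int.sign_eq_neg_one_of_neg h)
    · exact Or.inl (Int.sign_eq_one_of_pos h)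
  obtain ⟨u, v, w, hu, hv, hw, h⟩ := ternary (wg A + wg B + wg C + wg D + wg E) (by
    simp only [map_add, wsig_wg, hA1, hB1]
    rcases hs C hC with h1 | h1 <;> rcases hs D hD with h2 | h2 <;>
      rcases hs E hE with h3 | h3 <;> rw [h1, h2, h3] <;> norm_num)
  obtain ⟨p, q, r, s, t, h0, h1⟩ := five_of_three hA hB hC hD hE hu hv hw h
  refine ⟨ka * p, kb * q, kc * r, kd * s, ke * t, ?_, ?_⟩
  · simpa [hka, hkb, hkc, hkd, hke] using h0
  · rw [eA, eB, eC, eD, eE] at h1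
    linarith

theorem repr4 {a b c d e : ℚ} (ha : 0 < a) (hb : b < 0) (hc : c ≠ 0) (hd : d ≠ 0) (he : e ≠ 0) :
    ∃ p q r s : ℚ, a * p ^ 2 + b * q ^ 2 + c * r ^ 2 + d * s ^ 2 = e := by
  obtain ⟨p, q, r, s, t, h0, h1⟩ := five_iso ha hb hc hd (neg_ne_zero.2 he)
  by_cases ht : t = 0
  · subst ht
    have h2 : a * p ^ 2 + b * q ^ 2 + c * r ^ 2 + d * s ^ 2 = 0 := by linarith
    have key : ∀ x y : ℚ, x ≠ 0 → y ≠ 0 → ∃ k : ℚ, 2 * k * (x * y) + x = e := by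
      intro x y hx hy
      refine ⟨(e - x) / (2 * (x * y)), ?_⟩
      field_simp
      ring
    by_cases hp : p = 0
    · by_cases hq : q = 0
      · by_cases hr : r = 0
        · by_cases hs : s = 0
          · exact absurd ⟨hp, hq, hr, hs, rfl⟩ h0
          · obtain ⟨k, hk⟩ := key d s hd hs
            exact ⟨k * p, k * q, k * r, k * s + 1, by linear_combination k ^ 2 * h2 + hk⟩
        · obtain ⟨k, hk⟩ := key c r hc hr
          exact ⟨k * p, k * q, k * r + 1, k * s, by linear_combination k ^ 2 * h2 + hk⟩
      · obtain ⟨k, hk⟩ := key b q hb.ne hq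
        exact ⟨k * p, k * q + 1, k * r, k * s, by linear_combination k ^ 2 * h2 + hk⟩
    · obtain ⟨k, hk⟩ := key a p ha.ne' hp
      exact ⟨k * p + 1, k * q, k * r, k * s, by linear_combination k ^ 2 * h2 + hk⟩
  · refine ⟨p / t, q / t, r / t, s / t, ?_⟩
    field_simp
    linarith

theorem diagonalize {n : ℕ} (F : Matrix (Fin n) (Fin n) ℚ) (hF : F.IsSymm) :
    ∃ (P : Matrix (Fin n) (Fin n) ℚ) (w : Fin n → ℚ), P.det ≠ 0 ∧ Pᵀ * F * P = diagonal w := by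
  have hs : LinearMap.IsSymm (Matrix.toBilin' F) := by
    constructor
    intro x y
    simp only [RingHom.id_apply, Matrix.toBilin'_apply']
    rw [Matrix.dotProduct_mulVec, ← Matrix.mulVec_transpose, hF.eq, dotProduct_comm]
  let _ : Invertible (2 : ℚ) := invertibleOfNonzero two_ne_zero
  obtain ⟨v0, hv0⟩ := LinearMap.BilinForm.exists_orthogonal_basis hs
  have hn : Module.finrank ℚ (Fin n → ℚ) = n := by simp
  let v := v0.reindex (finCongr hn)
  have hv : ∀ i j, i ≠ j → Matrix.toBilin' F (v i) (v j) = 0 := by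
    intro i j hij
    simp only [v, Module.Basis.reindex_apply]
    exact hv0 (fun h => hij ((finCongr hn).symm.injective h))
  let P := (Pi.basisFun ℚ (Fin n)).toMatrix v
  have hP : ∀ i j, P i j = v j i := by intro i j; simp [P, Module.Basis.toMatrix_apply]
  have e : ∀ i j, (Pᵀ * F * P) i j = Matrix.toBilin' F (v i) (v j) := by
    intro i j
    rw [Matrix.toBilin'_apply, Matrix.mul_apply]
    simp only [Matrix.mul_apply, Matrix.transpose_apply, hP, Finset.sum_mul]
    rw [Finset.sum_comm]
  refine ⟨P, fun i => Matrix.toBilin' F (v i) (v i), ?_, ?_⟩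
  · have := (Pi.basisFun ℚ (Fin n)).isUnit_det v
    rw [Module.Basis.det_apply] at this
    exact this.ne_zero
  · ext i j
    rw [e, Matrix.diagonal_apply]
    split_ifs with h
    · rw [h]
    · exact hv i j h

theorem qeval_diag {n : ℕ} {R : Type*} [CommRing R] {F P : Matrix (Fin n) (Fin n) R} {w : Fin n → R}
    (h : Pᵀ * F * P = diagonal w) (y : Fin n → R) :
    qeval F (P *ᵥ y) = ∑ i, w i * y i ^ 2 := by
  have : qeval F (P *ᵥ y) = y ⬝ᵥ ((Pᵀ * F * P) *ᵥ y) := by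
    unfold qeval
    rw [← Matrix.mulVec_mulVec, ← Matrix.mulVec_mulVec, Matrix.dotProduct_mulVec y,
      Matrix.vecMul_transpose]
  rw [this, h]
  simp only [dotProduct, Matrix.mulVec_diagonal]
  exact Finset.sum_congr rfl fun i _ => by ring

theorem exists_notin {n : ℕ} (s : Finset (Fin n)) (h : s.card < n) : ∃ i, i ∉ s := by
  by_contra! hc
  have : s = Finset.univ := Finset.eq_univ_of_forall hc
  rw [this] at h
  simp at h

/-- Lemma (b). A nonsingular indefinite rational quadratic form in
`n ≥ 4` variables represents every nonzero rational number. -/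
theorem indefinite_represents_nonzero (n : ℕ) (hn : 4 ≤ n)
    (F : Matrix (Fin n) (Fin n) ℚ) (hFsymm : F.IsSymm) (hFns : F.det ≠ 0)
    (hindef : (∃ u : Fin n → ℝ, 0 < qeval (F.map (Rat.cast : ℚ → ℝ)) u) ∧
      (∃ w : Fin n → ℝ, qeval (F.map (Rat.cast : ℚ → ℝ)) w < 0))
    (b : ℚ) (hb : b ≠ 0) :
    ∃ v : Fin n → ℚ, v ≠ 0 ∧ qeval F v = b := by
  obtain ⟨P, w, hP, hD⟩ := diagonalize F hFsymm
  have hw : ∀ i, w i ≠ 0 := by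
    have h1 := congrArg Matrix.det hD
    rw [Matrix.det_mul, Matrix.det_mul, Matrix.det_transpose, Matrix.det_diagonal] at h1
    have h2 : ∏ i, w i ≠ 0 := by
      rw [← h1]; exact mul_ne_zero (mul_ne_zero hP hFns) hP
    intro i
    exact Finset.prod_ne_zero_iff.1 h2 i (Finset.mem_univ i)
  have hDR : (P.map (Rat.castHom ℝ))ᵀ * F.map (Rat.castHom ℝ) * P.map (Rat.castHom ℝ) =
      diagonal (fun i => (w i : ℝ)) := by
    have h1 := congrArg (fun M => M.map (Rat.castHom ℝ)) hD
    simp only [Matrix.map_mul] at h1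
    rw [← Matrix.transpose_map, h1, Matrix.diagonal_map (by simp)]
    rfl
  have hsurj : ∀ u : Fin n → ℝ, ∃ y : Fin n → ℝ,
      qeval (F.map (Rat.cast : ℚ → ℝ)) u = ∑ i, (w i : ℝ) * y i ^ 2 := by
    intro u
    have hu : IsUnit (P.map (Rat.castHom ℝ)).det := by
      have : (P.map (Rat.castHom ℝ)).det = (P.det : ℝ) := by
        have := RingHom.map_det (Rat.castHom ℝ) P
        simpa using this.symm
      rw [this, isUnit_iff_ne_zero]
      exact_mod_cast hP
    refine ⟨(P.map (Rat.castHom ℝ))⁻¹ *ᵥ u, ?_⟩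
    rw [← qeval_diag hDR, Matrix.mulVec_mulVec, Matrix.mul_nonsing_inv _ hu, Matrix.one_mulVec]
    rfl
  obtain ⟨⟨u, hu⟩, ⟨u', hu'⟩⟩ := hindef
  obtain ⟨i0, h0⟩ : ∃ i, 0 < w i := by
    by_contra! hc
    obtain ⟨y, hy⟩ := hsurj u
    rw [hy] at hu
    have : ∑ i, (w i : ℝ) * y i ^ 2 ≤ 0 := by
      apply Finset.sum_nonpos
      intro i _
      have : (w i : ℝ) ≤ 0 := by exact_mod_cast hc i
      exact mul_nonpos_of_nonpos_of_nonneg this (sq_nonneg _)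
    linarith
  obtain ⟨i1, h1⟩ : ∃ i, w i < 0 := by
    by_contra! hc
    obtain ⟨y, hy⟩ := hsurj u'
    rw [hy] at hu'
    have : 0 ≤ ∑ i, (w i : ℝ) * y i ^ 2 := by
      apply Finset.sum_nonneg
      intro i _
      have : 0 ≤ (w i : ℝ) := by exact_mod_cast hc i
      exact mul_nonneg this (sq_nonneg _)
    linarith
  obtain ⟨i2, h2⟩ := exists_notin {i0, i1} (lt_of_le_of_lt Finset.card_le_two (by omega))
  obtain ⟨i3, h3⟩ := exists_notin {i0, i1, i2} (lt_of_le_of_lt Finset.card_le_three (by omega))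
  have h01 : i0 ≠ i1 := by rintro rfl; linarith
  simp only [Finset.mem_insert, Finset.mem_singleton, not_or] at h2 h3
  obtain ⟨p, q, r, s, hpq⟩ := repr4 h0 h1 (hw i2) (hw i3) hb
  let y : Fin n → ℚ := fun i => if i = i0 then p else if i = i1 then q else if i = i2 then r
    else if i = i3 then s else 0
  have hy : ∑ i, w i * y i ^ 2 = b := by
    have : ∀ i, w i * y i ^ 2 = (if i = i0 then w i0 * p ^ 2 else 0) +
        (if i = i1 then w i1 * q ^ 2 else 0) + (if i = i2 then w i2 * r ^ 2 else 0) +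
        (if i = i3 then w i3 * s ^ 2 else 0) := by
      intro i
      by_cases e0 : i = i0
      · subst e0; simp [y, h01, Ne.symm h2.1, Ne.symm h3.1]
      by_cases e1 : i = i1
      · subst e1; simp [y, e0, Ne.symm h2.2, Ne.symm h3.2.1]
      by_cases e2 : i = i2
      · subst e2; simp [y, e0, e1, Ne.symm h3.2.2]
      by_cases e3 : i = i3
      · subst e3; simp [y, e0, e1, e2]
      simp [y, e0, e1, e2, e3]
    simp only [this, Finset.sum_add_distrib, Finset.sum_ite_eq', Finset.sum_ite_eq,
      Finset.mem_univ, if_true]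
    exact hpq
  refine ⟨P *ᵥ y, ?_, by rw [qeval_diag hD, hy]⟩
  intro hz
  apply hb
  rw [← hy, ← qeval_diag hD, hz]
  simp [qeval]
end Paper
end

section
/- Let K be a number field, i.e., a field extension of ℚ of finite degree. Then the set of prime numbers p for which there exists an element x ∈ K with x^2 = p is finite. -/
namespace Paper

open Matrix

lemma not_sq_aux {p q : ℕ} (hp : p.Prime) (hq : q.Prime) (hne : p ≠ q) (b : ℚ) :
    b ^ 2 ≠ ((p * q : ℕ) : ℚ) := by
  intro h
  have h1 : IsSquare (((p * q : ℕ)) : ℚ) := ⟨b, by rw [← h, sq]⟩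
  rw [Rat.isSquare_natCast_iff] at h1
  obtain ⟨n, hn⟩ := h1
  have hpn : p ∣ n := by
    have : p ∣ n * n := hn ▸ dvd_mul_right p q
    exact (hp.dvd_mul.1 this).elim id id
  obtain ⟨m, rfl⟩ := hpn
  have h2 : q = m * (p * m) := by
    apply Nat.eq_of_mul_eq_mul_left hp.pos
    rw [hn]; ring
  have h3 : p ∣ q := ⟨m * m, by rw [h2]; ring⟩
  exact hne ((Nat.prime_dvd_prime_iff_eq hp hq).1 h3)

lemma trace_aux {K : Type*} [Field K] [NumberField K] {a : ℚ} (ha : ∀ b : ℚ, b ^ 2 ≠ a)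
    {y : K} (hy : y ^ 2 = algebraMap ℚ K a) : Algebra.trace ℚ K y = 0 := by
  have hirr := X_pow_sub_C_irreducible_of_prime Nat.prime_two ha
  have hmin : Polynomial.X ^ 2 - Polynomial.C a = minpoly ℚ y :=
    minpoly.eq_of_irreducible_of_monic hirr (by simp [hy])
      (Polynomial.monic_X_pow_sub_C a two_ne_zero)
  rw [trace_eq_finrank_mul_minpoly_nextCoeff, ← hmin, Polynomial.nextCoeff,
    Polynomial.natDegree_X_pow_sub_C]
  simp [Polynomial.coeff_X_pow]

/-- In a number field, only finitely many prime numbers are squares. -/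
theorem finite_primes_with_sqrt (K : Type*) [Field K] [NumberField K] :
    {p : ℕ | p.Prime ∧ ∃ x : K, x ^ 2 = (p : K)}.Finite := by
  set S := {p : ℕ | p.Prime ∧ ∃ x : K, x ^ 2 = (p : K)} with hS
  choose x hx using fun p : S => p.2.2
  have hli : LinearIndependent ℚ x := by
    apply LinearMap.linearIndependent_of_isOrthoᵢ (B := Algebra.traceForm ℚ K)
    · rw [LinearMap.isOrthoᵢ_def]
      intro p q hpq
      rw [Algebra.traceForm_apply]
      apply trace_aux (not_sq_aux p.2.1 q.2.1 (fun h => hpq (Subtype.ext h)))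
      rw [mul_pow, hx, hx]; simp
    · intro p h
      rw [Algebra.traceForm_apply, ← sq, hx] at h
      have h2 := Algebra.trace_algebraMap (S := K) ((p : ℕ) : ℚ)
      rw [map_natCast, h] at h2
      have h3 : (Module.finrank ℚ K : ℚ) ≠ 0 := by exact_mod_cast Module.finrank_pos.ne'
      have h4 : ((p : ℕ) : ℚ) ≠ 0 := by exact_mod_cast p.2.1.ne_zero
      rw [nsmul_eq_mul] at h2
      exact mul_ne_zero h3 h4 h2.symm
  exact Set.finite_coe_iff.1 hli.finite

end Paper
end

section
/- The group O(q_3,ℤ) of integer matrices preserving the quadratic form q_3 = -x_0^2 + x_1^2 + x_2^2 + x_3^2 contains a finite-index subgroup Γ which admits a surjective group homomorphism Γ → ℤ whose kernel is finitely generated. -/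
namespace Paper

open Matrix

structure GoodH {G : Type*} [Group G] {ι : Type*} (s : ι → G) (h : G → ℤ) (W : Subgroup G)
    (adj : ι → ι → Prop) : Prop where
  inv : ∀ i, s i * s i = 1
  mem : ∀ i, s i ∈ W
  step : ∀ g ∈ W, ∀ i, h (g * s i) = h g + 1 ∨ h (g * s i) = h g - 1
  comm : ∀ i j, adj i j → s i * s j = s j * s i
  sq : ∀ i j, adj i j → ∀ g ∈ W, h (g * s i * s j) - h (g * s i) = h (g * s j) - h g
  link : ∀ g ∈ W, ∀ i j, h (g * s i) = h (g * s j) →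
    i = j ∨ adj i j ∨ ∃ k, adj i k ∧ adj k j ∧ h (g * s k) = h (g * s i)

theorem GoodH.neg {G : Type*} [Group G] {ι : Type*} {s : ι → G} {h : G → ℤ} {W : Subgroup G}
    {adj : ι → ι → Prop} (H : GoodH s h W adj) : GoodH s (fun g => - h g) W adj where
  inv := H.inv
  mem := H.mem
  step := fun g hg i => by have := H.step g hg i; omega
  comm := H.comm
  sq := fun i j a g hg => by have := H.sq i j a g hg; omega
  link := fun g hg i j e => by
    rcases H.link g hg i j (by simpa using e) with h1 | h1 | ⟨k, h1, h2, h3⟩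
    · exact Or.inl h1
    · exact Or.inr (Or.inl h1)
    · exact Or.inr (Or.inr ⟨k, h1, h2, by simpa using h3⟩)

def Stp {G : Type*} [Group G] {ι : Type*} (s : ι → G) (h : G → ℤ) (W : Subgroup G)
    (a b : ℤ) (x y : G) : Prop :=
  x ∈ W ∧ (∃ i, y = x * s i) ∧ a ≤ h x ∧ h x ≤ b ∧ a ≤ h y ∧ h y ≤ b

theorem Stp.mono {G : Type*} [Group G] {ι : Type*} {s : ι → G} {h : G → ℤ} {W : Subgroup G}
    {a b a' b' : ℤ} (ha : a' ≤ a) (hb : b ≤ b') {x y : G}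
    (H : Relation.ReflTransGen (Stp s h W a b) x y) :
    Relation.ReflTransGen (Stp s h W a' b') x y :=
  Relation.ReflTransGen.mono (r := Stp s h W a b) (fun x y ⟨h1, h2, h3, h4, h5, h6⟩ =>
    ⟨h1, h2, by omega, by omega, by omega, by omega⟩) x y H

theorem GoodH.sqpath {G : Type*} [Group G] {ι : Type*} {s : ι → G} {h : G → ℤ} {W : Subgroup G}
    {adj : ι → ι → Prop} (H : GoodH s h W adj) {a b : ℤ} (hab : a + 2 ≤ b) {y : G} (hy : y ∈ W)
    (hb : h y = b) {i j : ι} (hi : h (y * s i) = b - 1) (hj : h (y * s j) = b - 1)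
    (ad : adj i j) : Relation.ReflTransGen (Stp s h W a (b-1)) (y * s i) (y * s j) := by
  have h1 := H.sq i j ad y hy
  have e : y * s i * s j * s i = y * s j := by
    rw [mul_assoc y, H.comm i j ad, mul_assoc, mul_assoc, H.inv, mul_one]
  have m1 := W.mul_mem hy (H.mem i)
  have m2 := W.mul_mem m1 (H.mem j)
  refine Relation.ReflTransGen.head (b := y * s i * s j) ?_ (Relation.ReflTransGen.single ?_)
  · exact ⟨m1, ⟨j, rfl⟩, by omega, by omega, by omega, by omega⟩
  · exact ⟨m2, ⟨i, e.symm⟩, by omega, by omega, by omega, by omega⟩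

theorem GoodH.linkpath {G : Type*} [Group G] {ι : Type*} {s : ι → G} {h : G → ℤ} {W : Subgroup G}
    {adj : ι → ι → Prop} (H : GoodH s h W adj) {a b : ℤ} (hab : a + 2 ≤ b) {y : G} (hy : y ∈ W)
    (hb : h y = b) {i j : ι} (hi : h (y * s i) = b - 1) (hj : h (y * s j) = b - 1) :
    Relation.ReflTransGen (Stp s h W a (b-1)) (y * s i) (y * s j) := by
  rcases H.link y hy i j (by omega) with h1 | h1 | ⟨k, h1, h2, h3⟩
  · rw [h1]
  · exact H.sqpath hab hy hb hi hj h1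
  · exact (H.sqpath hab hy hb hi (by omega) h1).trans (H.sqpath hab hy hb (by omega) hj h2)

theorem GoodH.lower {G : Type*} [Group G] {ι : Type*} {s : ι → G} {h : G → ℤ} {W : Subgroup G}
    {adj : ι → ι → Prop} (H : GoodH s h W adj) {a b : ℤ} (hab : a + 2 ≤ b) {x y : G}
    (hx : h x ≤ b - 1) (hy : h y ≤ b - 1)
    (P : Relation.ReflTransGen (Stp s h W a b) x y) :
    Relation.ReflTransGen (Stp s h W a (b-1)) x y := by
  have key : (h y ≤ b - 1 → Relation.ReflTransGen (Stp s h W a (b-1)) x y) ∧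
      (h y = b → ∀ i, h (y * s i) = b - 1 →
        Relation.ReflTransGen (Stp s h W a (b-1)) x (y * s i)) := by
    clear hy
    induction P with
    | refl => exact ⟨fun _ => .refl, fun e => by omega⟩
    | @tail u v _ huv ih =>
      obtain ⟨hu, ⟨i, rfl⟩, h1, h2, h3, h4⟩ := huv
      have hst := H.step u hu i
      have e : u * s i * s i = u := by rw [mul_assoc, H.inv, mul_one]
      refine ⟨fun hv => ?_, fun hv j hj => ?_⟩
      · by_cases hub : h u = b
        · exact ih.2 hub i (by omega)
        · exact (ih.1 (by omega)).tail ⟨hu, ⟨i, rfl⟩, by omega, by omega, by omega, by omega⟩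
      · have := H.linkpath hab (W.mul_mem hu (H.mem i)) hv (i := i) (j := j)
          (by rw [e]; omega) hj
        rw [e] at this
        exact (ih.1 (by omega)).trans this
  exact key.1 hy

theorem Stp.neg {G : Type*} [Group G] {ι : Type*} {s : ι → G} {h : G → ℤ} {W : Subgroup G}
    {a b : ℤ} {x y : G}
    (H : Relation.ReflTransGen (Stp s h W a b) x y) :
    Relation.ReflTransGen (Stp s (fun g => - h g) W (-b) (-a)) x y :=
  Relation.ReflTransGen.mono (r := Stp s h W a b) (fun x y ⟨h1, h2, h3, h4, h5, h6⟩ =>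
    ⟨h1, h2, by simpa, by simpa, by simpa, by simpa⟩) x y H

theorem GoodH.raise {G : Type*} [Group G] {ι : Type*} {s : ι → G} {h : G → ℤ} {W : Subgroup G}
    {adj : ι → ι → Prop} (H : GoodH s h W adj) {a b : ℤ} (hab : a + 2 ≤ b) {x y : G}
    (hx : a + 1 ≤ h x) (hy : a + 1 ≤ h y)
    (P : Relation.ReflTransGen (Stp s h W a b) x y) :
    Relation.ReflTransGen (Stp s h W (a+1) b) x y := by
  have := (H.neg.lower (a := -b) (b := -a) (by omega) (by omega) (by omega) (Stp.neg P))
  have := Stp.neg this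
  simpa [add_comm] using this

theorem GoodH.conn {G : Type*} [Group G] {ι : Type*} {s : ι → G} {h : G → ℤ}
    {adj : ι → ι → Prop} (H : GoodH s h (Subgroup.closure (Set.range s)) adj) (h1 : h 1 = 0)
    {g : G} (hg : g ∈ Subgroup.closure (Set.range s)) (g0 : 0 ≤ h g) (g1 : h g ≤ 1) :
    Relation.ReflTransGen (Stp s h (Subgroup.closure (Set.range s)) 0 1) 1 g := by
  set W := Subgroup.closure (Set.range s) with hW
  have A : ∃ n : ℕ, Relation.ReflTransGen (Stp s h W (-n) (n+1)) 1 g := by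
    clear g0 g1
    have st : ∀ x, x ∈ W → ∀ i, (∃ n : ℕ, Relation.ReflTransGen (Stp s h W (-n) (n+1)) 1 x) →
        ∃ n : ℕ, Relation.ReflTransGen (Stp s h W (-n) (n+1)) 1 (x * s i) := by
      rintro x hx i ⟨n, hn⟩
      refine ⟨n + (h x).natAbs + (h (x * s i)).natAbs, ?_⟩
      refine (Stp.mono (by omega) (by omega) hn).tail ?_
      refine ⟨hx, ⟨i, rfl⟩, by omega, by omega, by omega, by omega⟩
    induction hg using Subgroup.closure_induction_right with
    | one => exact ⟨0, .refl⟩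
    | mul_right x hx y hy ih =>
      obtain ⟨i, rfl⟩ := hy
      exact st x hx i ih
    | mul_inv_cancel x hx y hy ih =>
      obtain ⟨i, rfl⟩ := hy
      rw [inv_eq_of_mul_eq_one_right (H.inv i)]
      exact st x hx i ih
  obtain ⟨n, hn⟩ := A
  clear hg
  induction n with
  | zero => simpa using hn
  | succ n ih =>
    apply ih
    push_cast at hn
    have h2 := H.lower (by omega) (by omega) (by omega) hn
    have h3 := H.raise (by omega) (by omega) (by omega) h2
    refine Stp.mono (by omega) (by omega) h3

theorem GoodH.fg {G : Type*} [Group G] {ι : Type*} [Finite ι] {s : ι → G} {h : G → ℤ}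
    {adj : ι → ι → Prop} (H : GoodH s h (Subgroup.closure (Set.range s)) adj) (h1 : h 1 = 0)
    (Γ : Subgroup G) [Γ.FiniteIndex] (hle : Γ ≤ Subgroup.closure (Set.range s))
    (hΓ : ∀ γ ∈ Γ, ∀ g ∈ Subgroup.closure (Set.range s), h (γ * g) = h γ + h g)
    (K : Subgroup G) (hK : ∀ k, k ∈ K ↔ k ∈ Γ ∧ h k = 0) : K.FG := by
  classical
  set W := Subgroup.closure (Set.range s) with hW
  let V : Set G := {g | g ∈ W ∧ 0 ≤ h g ∧ h g ≤ 1}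
  let c : G → (G ⧸ Γ) × Bool := fun g => (((g⁻¹ : G) : G ⧸ Γ), decide (h g = 0))
  let r : (G ⧸ Γ) × Bool → G := fun q => if hq : ∃ g ∈ V, c g = q then hq.choose else 1
  let F : Set G := insert 1 (Set.range r)
  have Ffin : F.Finite := (Set.finite_range r).insert 1
  have rep : ∀ g ∈ V, ∃ f ∈ F, g * f⁻¹ ∈ K := by
    intro g hg
    have hq : ∃ g' ∈ V, c g' = c g := ⟨g, hg, rfl⟩
    have e : r (c g) = hq.choose := dif_pos hq
    obtain ⟨m1, m2⟩ := hq.choose_spec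
    rw [← e] at m1 m2
    refine ⟨r (c g), Or.inr ⟨_, rfl⟩, ?_⟩
    set f := r (c g)
    obtain ⟨e1, e2⟩ := Prod.ext_iff.mp m2
    have e3 : g * f⁻¹ ∈ Γ := by
      have := QuotientGroup.eq.mp e1
      have := Γ.inv_mem this
      simpa using this
    refine (hK _).mpr ⟨e3, ?_⟩
    have := hΓ _ e3 f m1.1
    rw [inv_mul_cancel_right] at this
    have e4 : h f = 0 ↔ h g = 0 := by simpa [c] using e2
    have := m1.2; have := hg.2
    omega
  let A : Set G := {k | k ∈ K ∧ ((∃ f ∈ F, ∃ f' ∈ F, ∃ i, k = f * s i * f'⁻¹) ∨ k ∈ F)}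
  have Afin : A.Finite := by
    have : A ⊆ ((fun q : (G × G) × ι => q.1.1 * s q.2 * q.1.2⁻¹) '' ((F ×ˢ F) ×ˢ Set.univ)) ∪ F := by
      rintro k ⟨_, ⟨f, hf, f', hf', i, rfl⟩ | hk⟩
      · exact Or.inl ⟨((f, f'), i), ⟨⟨hf, hf'⟩, trivial⟩, rfl⟩
      · exact Or.inr hk
    exact ((((Ffin.prod Ffin).prod Set.finite_univ).image _).union Ffin).subset this
  have AK : Subgroup.closure A ≤ K := (Subgroup.closure_le _).mpr fun k hk => hk.1
  have main : ∀ g, Relation.ReflTransGen (Stp s h W 0 1) 1 g →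
      ∃ f ∈ F, g * f⁻¹ ∈ Subgroup.closure A := by
    intro g P
    induction P with
    | refl => exact ⟨1, Or.inl rfl, by simp⟩
    | @tail u v _ huv ih =>
      obtain ⟨f, hf, hu⟩ := ih
      obtain ⟨hu1, ⟨i, rfl⟩, h1, h2, h3, h4⟩ := huv
      obtain ⟨f', hf', hk⟩ := rep (u * s i) ⟨W.mul_mem hu1 (H.mem i), h3, h4⟩
      refine ⟨f', hf', ?_⟩
      have e : u * s i * f'⁻¹ = (u * f⁻¹) * (f * s i * f'⁻¹) := by group
      have : f * s i * f'⁻¹ ∈ K := by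
        have : f * s i * f'⁻¹ = (u * f⁻¹)⁻¹ * (u * s i * f'⁻¹) := by group
        rw [this]
        exact K.mul_mem (K.inv_mem (AK hu)) hk
      rw [e]
      exact Subgroup.mul_mem _ hu (Subgroup.subset_closure ⟨this, Or.inl ⟨f, hf, f', hf', i, rfl⟩⟩)
  refine (Subgroup.fg_iff _).mpr ⟨A, le_antisymm AK fun k hk => ?_, Afin⟩
  obtain ⟨k1, k2⟩ := (hK k).mp hk
  obtain ⟨f, hf, hm⟩ := main k (H.conn h1 (hle k1) (by omega) (by omega))
  have fK : f ∈ K := by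
    have : f = (k * f⁻¹)⁻¹ * k := by group
    rw [this]; exact K.mul_mem (K.inv_mem (AK hm)) hk
  have : k = (k * f⁻¹) * f := by group
  rw [this]
  exact Subgroup.mul_mem _ hm (Subgroup.subset_closure ⟨fK, Or.inr hf⟩)

theorem GoodH.final {G : Type*} [Group G] {ι : Type*} [Finite ι] {s : ι → G} {h : G → ℤ}
    {adj : ι → ι → Prop} (H : GoodH s h (Subgroup.closure (Set.range s)) adj) (h1 : h 1 = 0)
    (Γ : Subgroup G) [Γ.FiniteIndex] (hle : Γ ≤ Subgroup.closure (Set.range s))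
    (hΓ : ∀ γ ∈ Γ, ∀ g ∈ Subgroup.closure (Set.range s), h (γ * g) = h γ + h g)
    (hne : ∃ γ ∈ Γ, h γ ≠ 0) :
    ∃ φ : ↥Γ →* Multiplicative ℤ, Function.Surjective φ ∧ Group.FG ↥φ.ker := by
  let S : AddSubgroup ℤ :=
    { carrier := {n | ∃ γ ∈ Γ, h γ = n}
      zero_mem' := ⟨1, Γ.one_mem, h1⟩
      add_mem' := by
        rintro _ _ ⟨x, hx, rfl⟩ ⟨y, hy, rfl⟩
        exact ⟨x * y, Γ.mul_mem hx hy, hΓ x hx y (hle hy)⟩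
      neg_mem' := by
        rintro _ ⟨x, hx, rfl⟩
        refine ⟨x⁻¹, Γ.inv_mem hx, ?_⟩
        have := hΓ x hx x⁻¹ (hle (Γ.inv_mem hx))
        rw [mul_inv_cancel] at this
        omega }
  obtain ⟨d, hd⟩ := Int.subgroup_cyclic S
  have dvd : ∀ γ ∈ Γ, d ∣ h γ := by
    intro γ hγ
    have : h γ ∈ S := ⟨γ, hγ, rfl⟩
    rw [hd, AddSubgroup.mem_closure_singleton] at this
    obtain ⟨n, hn⟩ := this
    exact ⟨n, by rw [← hn]; simp [mul_comm]⟩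
  have d0 : d ≠ 0 := by
    rintro rfl
    obtain ⟨γ, hγ, h0⟩ := hne
    exact h0 (zero_dvd_iff.mp (dvd γ hγ))
  let φ : ↥Γ →* Multiplicative ℤ := MonoidHom.mk' (fun γ => Multiplicative.ofAdd (h γ / d)) (by
    intro x y
    rw [← ofAdd_add]
    congr 1
    rw [Subgroup.coe_mul, hΓ x x.2 y (hle y.2), Int.add_ediv_of_dvd_left (dvd x x.2)])
  refine ⟨φ, ?_, ?_⟩
  · intro n
    have : n.toAdd * d ∈ S := by
      rw [hd, AddSubgroup.mem_closure_singleton]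
      exact ⟨n.toAdd, by simp⟩
    obtain ⟨γ, hγ, e⟩ := this
    refine ⟨⟨γ, hγ⟩, ?_⟩
    change Multiplicative.ofAdd (h γ / d) = n
    rw [e, Int.mul_ediv_cancel _ d0]
    rfl
  · have hk : ∀ x : Γ, x ∈ φ.ker ↔ h x = 0 := by
      intro x
      rw [MonoidHom.mem_ker]
      change Multiplicative.ofAdd (h x / d) = Multiplicative.ofAdd 0 ↔ _
      rw [Multiplicative.ofAdd.apply_eq_iff_eq]
      obtain ⟨n, hn⟩ := dvd x x.2
      rw [hn, Int.mul_ediv_cancel_left _ d0]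
      simp [d0]
    have fg := H.fg h1 Γ hle hΓ (φ.ker.map Γ.subtype) (by
      intro k
      constructor
      · rintro ⟨x, hx, rfl⟩
        exact ⟨x.2, (hk x).mp hx⟩
      · rintro ⟨h2, h3⟩
        exact ⟨⟨k, h2⟩, (hk _).mpr h3, rfl⟩)
    have := (Group.fg_iff_subgroup_fg _).mpr fg
    exact Group.fg_of_surjective
      (f := (φ.ker.equivMapOfInjective Γ.subtype Γ.subtype_injective).symm.toMonoidHom)
      (MulEquiv.surjective _)

def act (g : ↥(OZ q3)) (v : Fin 4 → ℤ) : Fin 4 → ℤ :=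
  ((g : GL (Fin 4) ℤ) : Matrix (Fin 4) (Fin 4) ℤ) *ᵥ v

def BB (v w : Fin 4 → ℤ) : ℤ := -(v 0 * w 0) + v 1 * w 1 + v 2 * w 2 + v 3 * w 3

theorem act_mul (g h : ↥(OZ q3)) (v) : act (g * h) v = act g (act h v) := by
  simp [act, Matrix.mulVec_mulVec]

theorem act_one (v) : act 1 v = v := by simp [act]

theorem act_add (g) (v w) : act g (v + w) = act g v + act g w := by
  simp [act, Matrix.mulVec_add]

theorem act_sub (g) (v w) : act g (v - w) = act g v - act g w := by
  simp [act, Matrix.mulVec_sub]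

theorem act_neg (g) (v) : act g (-v) = -act g v := by
  simp [act, Matrix.mulVec_neg]

theorem act_smul (g) (c : ℤ) (v) : act g (c • v) = c • act g v := by
  exact Matrix.mulVec_smul _ _ _

theorem act_ext {g h : ↥(OZ q3)} (H : ∀ v, act g v = act h v) : g = h := by
  apply Subtype.ext
  apply Units.ext
  exact Matrix.mulVec_injective (funext H)

theorem qeval_q3 (x : Fin 4 → ℚ) : qeval q3 x = -(x 0)^2 + (x 1)^2 + (x 2)^2 + (x 3)^2 := by
  simp [qeval, q3, dotProduct, Matrix.mulVec_diagonal, Fin.sum_univ_four]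
  ring

theorem BB_self_act (g) (v) : BB (act g v) (act g v) = BB v v := by
  have := g.2 (fun i => (v i : ℚ))
  have e : (((g : GL (Fin 4) ℤ) : Matrix (Fin 4) (Fin 4) ℤ).map (algebraMap ℤ ℚ)) *ᵥ
      (fun i => (v i : ℚ)) = fun i => ((act g v i : ℤ) : ℚ) := by
    funext i
    simp [act, Matrix.mulVec, dotProduct]
  rw [e, qeval_q3, qeval_q3] at this
  have h2 : ((BB (act g v) (act g v) : ℤ) : ℚ) = ((BB v v : ℤ) : ℚ) := by
    simp only [BB]; push_cast; linarith
  exact_mod_cast h2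

theorem BB_act (g) (v w) : BB (act g v) (act g w) = BB v w := by
  have h1 := BB_self_act g v
  have h2 := BB_self_act g w
  have h3 := BB_self_act g (v + w)
  rw [act_add] at h3
  simp only [BB, Pi.add_apply] at *
  linarith

def al : Fin 6 → Fin 4 → ℤ :=
  ![![0,1,0,0], ![0,0,1,0], ![0,0,0,1], ![1,0,1,1], ![1,1,0,1], ![1,1,1,0]]

def Rm (a : Fin 4 → ℤ) : Matrix (Fin 4) (Fin 4) ℤ :=
  Matrix.of fun i j => (if i = j then 1 else 0) - 2 * a i * (if j = 0 then -a j else a j)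

theorem Rm_mulVec (a v : Fin 4 → ℤ) : Rm a *ᵥ v = v - (2 * BB v a) • a := by
  funext i
  fin_cases i <;>
    simp [Rm, Matrix.mulVec, dotProduct, Fin.sum_univ_four, BB] <;> ring

theorem Rm_sq (a : Fin 4 → ℤ) (ha : BB a a = 1) : Rm a * Rm a = 1 := by
  apply Matrix.mulVec_injective
  funext v
  rw [← Matrix.mulVec_mulVec, Rm_mulVec, Rm_mulVec, Matrix.one_mulVec]
  have : BB (v - (2 * BB v a) • a) a = - BB v a := by
    have : BB (v - (2 * BB v a) • a) a = BB v a - 2 * BB v a * BB a a := by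
      simp [BB]; ring
    rw [this, ha]; ring
  rw [this]
  funext i
  simp

theorem al_norm (j) : BB (al j) (al j) = 1 := by
  revert j; decide

def ss (j : Fin 6) : ↥(OZ q3) :=
  ⟨⟨Rm (al j), Rm (al j), Rm_sq _ (al_norm j), Rm_sq _ (al_norm j)⟩, by
    intro x
    rw [qeval_q3, qeval_q3]
    fin_cases j <;>
    simp [Rm, al, Matrix.mulVec, dotProduct, Fin.sum_univ_four] <;> ring⟩

theorem act_ss (j v) : act (ss j) v = v - (2 * BB v (al j)) • al j := Rm_mulVec _ _

theorem ss_sq (j) : ss j * ss j = 1 := by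
  apply Subtype.ext
  apply Units.ext
  exact Rm_sq _ (al_norm j)

def zz : ↥(OZ q3) := ⟨-1, by
    intro x
    rw [qeval_q3, qeval_q3]
    simp [Matrix.mulVec, dotProduct, Matrix.one_apply]⟩

theorem act_zz (v) : act zz v = -v := by
  simp [act, zz, Matrix.neg_mulVec]

theorem wall_a (x0 x1 x2 x3 : ℤ) (hq : -(x0 * x0) + x1 * x1 + x2 * x2 + x3 * x3 = 1)
    (h : (0 < -3 * x0 + x1 + x2 + x3 ∧ -3 * x0 - x1 + x2 + x3 ≤ 0) ∨
      (-3 * x0 + x1 + x2 + x3 ≤ 0 ∧ 0 < -3 * x0 - x1 + x2 + x3)) :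
    x0 = 0 ∧ x2 = 0 ∧ x3 = 0 ∧ (x1 = 1 ∨ x1 = -1) := by
  have hm : (-3 * x0 + x2 + x3) * (-3 * x0 + x2 + x3) ≤ x1 * x1 := by
    rcases h with ⟨h1, h2⟩ | ⟨h1, h2⟩ <;> nlinarith
  have h0 : x0 * x0 < 1 := by
    nlinarith [sq_nonneg (-3 * x0 + x2 + x3 + x2), sq_nonneg (-3 * x0 + x2 + x3 + x3),
      sq_nonneg (x2 - x3)]
  have h0' : x0 = 0 := by nlinarith
  subst h0'
  have b1 : -1 ≤ x1 ∧ x1 ≤ 1 := ⟨by nlinarith, by nlinarith⟩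
  have b2 : -1 ≤ x2 ∧ x2 ≤ 1 := ⟨by nlinarith, by nlinarith⟩
  have b3 : -1 ≤ x3 ∧ x3 ≤ 1 := ⟨by nlinarith, by nlinarith⟩
  obtain ⟨b1, b1'⟩ := b1
  obtain ⟨b2, b2'⟩ := b2
  obtain ⟨b3, b3'⟩ := b3
  interval_cases x1 <;> interval_cases x2 <;> interval_cases x3 <;> simp_all

def pp : Fin 4 → ℤ := ![3,1,1,1]

theorem wall (j : Fin 6) (v : Fin 4 → ℤ) (hv : BB v v = 1)
    (h : ¬ (0 < BB v pp ↔ 0 < BB v (act (ss j) pp))) : v = al j ∨ v = -al j := by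
  rw [act_ss] at h
  have key : (v 0 = al j 0 ∧ v 1 = al j 1 ∧ v 2 = al j 2 ∧ v 3 = al j 3) ∨
    (v 0 = -al j 0 ∧ v 1 = -al j 1 ∧ v 2 = -al j 2 ∧ v 3 = -al j 3) := by
    simp only [BB, pp] at h hv
    generalize v 0 = x0 at *
    generalize v 1 = x1 at *
    generalize v 2 = x2 at *
    generalize v 3 = x3 at *
    fin_cases j <;> simp [al] at h ⊢
    · have := wall_a x0 x1 x2 x3 (by linarith) (by omega)
      omega
    · have := wall_a x0 x2 x1 x3 (by linarith) (by omega)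
      omega
    · have := wall_a x0 x3 x1 x2 (by linarith) (by omega)
      omega
    · have := wall_a (x0 - (-x0 + x1 + x2 + x3)) (x1 - (-x0 + x1 + x2 + x3))
        (x2 - (-x0 + x1 + x2 + x3)) (x3 - (-x0 + x1 + x2 + x3)) (by linarith) (by omega)
      omega
    · have := wall_a (x0 - (-x0 + x1 + x2 + x3)) (x2 - (-x0 + x1 + x2 + x3))
        (x1 - (-x0 + x1 + x2 + x3)) (x3 - (-x0 + x1 + x2 + x3)) (by linarith) (by omega)
      omega
    · have := wall_a (x0 - (-x0 + x1 + x2 + x3)) (x3 - (-x0 + x1 + x2 + x3))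
        (x1 - (-x0 + x1 + x2 + x3)) (x2 - (-x0 + x1 + x2 + x3)) (by linarith) (by omega)
      omega
  rcases key with ⟨h0, h1, h2, h3⟩ | ⟨h0, h1, h2, h3⟩
  · left; funext i; fin_cases i <;> assumption
  · right; funext i; fin_cases i <;> assumption

theorem ss_comm (i j) (h : BB (al i) (al j) = 0) : ss i * ss j = ss j * ss i := by
  apply act_ext
  intro v
  rw [act_mul, act_mul, act_ss i, act_ss j, act_ss i, act_ss j]
  have e1 : BB (v - (2 * BB v (al j)) • al j) (al i) = BB v (al i) := by
    have : BB (v - (2 * BB v (al j)) • al j) (al i) = BB v (al i) - 2 * BB v (al j) * BB (al i) (al j) := by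
      simp [BB]; ring
    rw [this, h]; ring
  have e2 : BB (v - (2 * BB v (al i)) • al i) (al j) = BB v (al j) := by
    have : BB (v - (2 * BB v (al i)) • al i) (al j) = BB v (al j) - 2 * BB v (al i) * BB (al i) (al j) := by
      simp [BB]; ring
    rw [this, h]; ring
  rw [e1, e2]
  abel

theorem act_ss_orth (i j) (h : BB (al i) (al j) = 0) : act (ss i) (al j) = al j := by
  rw [act_ss]
  have : BB (al j) (al i) = 0 := by rw [← h]; simp [BB]; ring
  rw [this]; simp

def pos (v : Fin 4 → ℤ) : Prop :=
  if v 0 % 2 = 0 then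
    (if v 1 % 2 = 1 then (v 1 + v 2) % 4 = 1
      else if v 2 % 2 = 1 then (v 2 + v 3) % 4 = 1 else (v 3 + v 1) % 4 = 1)
  else (if v 2 % 2 = 0 then v 1 % 4 = 1 else if v 3 % 2 = 0 then v 2 % 4 = 1 else v 3 % 4 = 1)

instance : DecidablePred pos := fun v => by unfold pos; infer_instance

theorem pos_congr {u v : Fin 4 → ℤ} (h : ∀ k, (4 : ℤ) ∣ u k - v k) : pos u ↔ pos v := by
  have h0 := h 0
  have h1 := h 1
  have h2 := h 2
  have h3 := h 3
  have e0 : u 0 % 2 = v 0 % 2 := by omega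
  have e1 : u 1 % 2 = v 1 % 2 := by omega
  have e2 : u 2 % 2 = v 2 % 2 := by omega
  have e3 : u 3 % 2 = v 3 % 2 := by omega
  have f1 : (u 1 + u 2) % 4 = (v 1 + v 2) % 4 := by omega
  have f2 : (u 2 + u 3) % 4 = (v 2 + v 3) % 4 := by omega
  have f3 : (u 3 + u 1) % 4 = (v 3 + v 1) % 4 := by omega
  have g1 : u 1 % 4 = v 1 % 4 := by omega
  have g2 : u 2 % 4 = v 2 % 4 := by omega
  have g3 : u 3 % 4 = v 3 % 4 := by omega
  unfold pos
  rw [e0, e1, e2, e3, f1, f2, f3, g1, g2, g3]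

def C2 (g : ↥(OZ q3)) : Prop := ∀ v k, (2 : ℤ) ∣ act g v k - v k

theorem C2_mul {g h} (hg : C2 g) (hh : C2 h) : C2 (g * h) := by
  intro v k
  rw [act_mul]
  have := hg (act h v) k
  have := hh v k
  omega

theorem C2_ss (j) : C2 (ss j) := by
  intro v k
  rw [act_ss]
  refine ⟨-(BB v (al j) * al j k), ?_⟩
  simp; ring

theorem pos_al (g) (hg : C2 g) : (pos (act g (al 0)) ↔ (act g (al 0) 1 + act g (al 0) 2) % 4 = 1) ∧
    (pos (act g (al 1)) ↔ (act g (al 1) 2 + act g (al 1) 3) % 4 = 1) ∧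
    (pos (act g (al 2)) ↔ (act g (al 2) 3 + act g (al 2) 1) % 4 = 1) ∧
    (pos (act g (al 3)) ↔ (act g (al 3) 3) % 4 = 1) ∧
    (pos (act g (al 4)) ↔ (act g (al 4) 1) % 4 = 1) ∧
    (pos (act g (al 5)) ↔ (act g (al 5) 2) % 4 = 1) := by
  refine ⟨?_, ?_, ?_, ?_, ?_, ?_⟩
  · have a0 := hg (al 0) 0; have a1 := hg (al 0) 1
    simp [al] at a0 a1 
    unfold pos
    rw [if_pos (by simp [al]; omega), if_pos (by simp [al]; omega)]
  · have a0 := hg (al 1) 0; have a1 := hg (al 1) 1; have a2 := hg (al 1) 2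
    simp [al] at a0 a1 a2
    unfold pos
    rw [if_pos (by simp [al]; omega), if_neg (by simp [al]; omega), if_pos (by simp [al]; omega)]
  · have a0 := hg (al 2) 0; have a1 := hg (al 2) 1; have a2 := hg (al 2) 2
    simp [al] at a0 a1 a2
    unfold pos
    rw [if_pos (by simp [al]; omega), if_neg (by simp [al]; omega), if_neg (by simp [al]; omega)]
  · have a0 := hg (al 3) 0; have a2 := hg (al 3) 2; have a3 := hg (al 3) 3
    simp [al] at a0 a2 a3
    unfold pos
    rw [if_neg (by simp [al]; omega), if_neg (by simp [al]; omega), if_neg (by simp [al]; omega)]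
  · have a0 := hg (al 4) 0; have a2 := hg (al 4) 2
    simp [al] at a0 a2
    unfold pos
    rw [if_neg (by simp [al]; omega), if_pos (by simp [al]; omega)]
  · have a0 := hg (al 5) 0; have a2 := hg (al 5) 2; have a3 := hg (al 5) 3
    simp [al] at a0 a2 a3
    unfold pos
    rw [if_neg (by simp [al]; omega), if_neg (by simp [al]; omega), if_pos (by simp [al]; omega)]

theorem pos_neg (v : Fin 4 → ℤ) (j : Fin 6) (h : ∀ k, (2 : ℤ) ∣ v k - al j k) :
    pos (-v) ↔ ¬ pos v := by
  have h0 := h 0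
  have h1 := h 1
  have h2 := h 2
  have h3 := h 3
  unfold pos
  simp only [Pi.neg_apply]
  generalize v 0 = x0 at *
  generalize v 1 = x1 at *
  generalize v 2 = x2 at *
  generalize v 3 = x3 at *
  fin_cases j <;> simp [al] at h0 h1 h2 h3 <;> split_ifs <;> omega

theorem pairlem (t m n p y0 ym yn yp z0 zm zn zp : ℤ)
    (h1 : -(t * t) + m * m + n * n + p * p = 1)
    (h2 : -(t * y0) + m * ym + n * yn + p * yp = 0)
    (h3 : -(t * z0) + m * zm + n * zn + p * zp = 0)
    (ht : 2 ∣ t) (hm : 2 ∣ m - 1) (hn : 2 ∣ n) (hp : 2 ∣ p)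
    (hy0 : 2 ∣ y0 - 1) (hym : 2 ∣ ym) (hyn : 2 ∣ yn) (hyp : 2 ∣ yp)
    (hz0 : 2 ∣ z0) (hzm : 2 ∣ zm) (hzn : 2 ∣ zn) (hzp : 2 ∣ zp - 1) :
    4 ∣ n - ym - zm := by
  obtain ⟨a, rfl⟩ := ht
  obtain ⟨b, hb⟩ := hm
  obtain rfl : m = 1 + 2 * b := by linarith
  obtain ⟨c, rfl⟩ := hn
  obtain ⟨d, rfl⟩ := hp
  obtain ⟨a', hb⟩ := hy0
  obtain rfl : y0 = 1 + 2 * a' := by linarith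
  obtain ⟨b', rfl⟩ := hym
  obtain ⟨c', rfl⟩ := hyn
  obtain ⟨d', rfl⟩ := hyp
  obtain ⟨a'', rfl⟩ := hz0
  obtain ⟨b'', rfl⟩ := hzm
  obtain ⟨c'', rfl⟩ := hzn
  obtain ⟨d'', hb⟩ := hzp
  obtain rfl : zp = 1 + 2 * d'' := by linarith
  have sq : ∀ x : ℤ, ∃ k, x * x = x + 2 * k := fun x => by
    obtain ⟨k, hk⟩ := Int.even_mul_pred_self x
    exact ⟨k, by linarith⟩
  obtain ⟨k1, e1⟩ := sq a
  obtain ⟨k2, e2⟩ := sq b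
  obtain ⟨k3, e3⟩ := sq c
  obtain ⟨k4, e4⟩ := sq d
  have r1 : -a + c + d = 2 * (k1 - k2 - k3 - k4 - b) := by linarith
  have r2 : b' - a = 2 * (a * a' - b * b' - c * c' - d * d') := by linarith
  have r3 : b'' + d = 2 * (a * a'' - b * b'' - c * c'' - d * d'') := by linarith
  omega

theorem pairing (g) (hg : C2 g) : (pos (act g (al 0)) ↔ pos (act g (al 4))) ∧
    (pos (act g (al 1)) ↔ pos (act g (al 5))) ∧ (pos (act g (al 2)) ↔ pos (act g (al 3))) := by
  obtain ⟨p0, p1, p2, p3, p4, p5⟩ := pos_al g hg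
  rw [p0, p1, p2, p3, p4, p5]
  let e : Fin 4 → ℤ := ![1,0,0,0]
  have a3 : al 3 = e + al 1 + al 2 := by decide
  have a4 : al 4 = e + al 0 + al 2 := by decide
  have a5 : al 5 = e + al 0 + al 1 := by decide
  rw [a3, a4, a5]
  simp only [act_add, Pi.add_apply]
  have H : ∀ v w, BB (act g v) (act g w) = BB v w := BB_act g
  have c0 := fun k => hg e k
  have c1 := fun k => hg (al 0) k
  have c2 := fun k => hg (al 1) k
  have c3 := fun k => hg (al 2) k
  have n11 := H (al 0) (al 0)
  have n22 := H (al 1) (al 1)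
  have n33 := H (al 2) (al 2)
  have n10 := H (al 0) e
  have n20 := H (al 1) e
  have n30 := H (al 2) e
  have n13 := H (al 0) (al 2)
  have n21 := H (al 1) (al 0)
  have n32 := H (al 2) (al 1)
  generalize act g e = x0 at *
  generalize act g (al 0) = x1 at *
  generalize act g (al 1) = x2 at *
  generalize act g (al 2) = x3 at *
  simp only [Fin.forall_fin_succ, Fin.forall_fin_zero] at c0 c1 c2 c3
  simp [BB, al, e] at n11 n22 n33 n10 n20 n30 n13 n21 n32 c0 c1 c2 c3
  obtain ⟨c00, c01, c02, c03⟩ := c0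
  obtain ⟨c10, c11, c12, c13⟩ := c1
  obtain ⟨c20, c21, c22, c23⟩ := c2
  obtain ⟨c30, c31, c32, c33⟩ := c3
  have q1 := pairlem (x1 0) (x1 1) (x1 2) (x1 3) (x0 0) (x0 1) (x0 2) (x0 3) (x3 0) (x3 1) (x3 2) (x3 3)
    (by linarith) (by linarith) (by linarith) c10 c11 c12 c13 c00 c01 c02 c03 c30 c31 c32 c33
  have q2 := pairlem (x2 0) (x2 2) (x2 3) (x2 1) (x0 0) (x0 2) (x0 3) (x0 1) (x1 0) (x1 2) (x1 3) (x1 1)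
    (by linarith) (by linarith) (by linarith) c20 c22 c23 c21 c00 c02 c03 c01 c10 c12 c13 c11
  have q3 := pairlem (x3 0) (x3 3) (x3 1) (x3 2) (x0 0) (x0 3) (x0 1) (x0 2) (x2 0) (x2 3) (x2 1) (x2 2)
    (by linarith) (by linarith) (by linarith) c30 c33 c31 c32 c00 c03 c01 c02 c20 c23 c21 c22
  refine ⟨?_, ?_, ?_⟩ <;> omega

def ff (x v : Fin 4 → ℤ) : ℤ := if BB v v = 1 ∧ pos v ∧ 0 < BB v x then 1 else 0

noncomputable def hh (g : ↥(OZ q3)) : ℤ := ∑ᶠ v, (ff (act g pp) v - ff pp v)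

theorem act_inv (g v) : act g (act g⁻¹ v) = v := by rw [← act_mul, mul_inv_cancel, act_one]

theorem supp1 (g j) : Function.support (fun v => ff (act (g * ss j) pp) v - ff (act g pp) v) ⊆
    (({act g (al j), -act g (al j)} : Finset (Fin 4 → ℤ)) : Set (Fin 4 → ℤ)) := by
  intro v hv
  have h1 : BB v v = 1 := by
    by_contra h
    apply hv
    simp [ff, h]
  have hu := act_inv g v
  set u := act g⁻¹ v
  have h2 : ¬ (0 < BB u pp ↔ 0 < BB u (act (ss j) pp)) := by
    intro h
    apply hv
    rw [← BB_act g u pp, ← BB_act g u (act (ss j) pp), hu, ← act_mul] at h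
    simp [ff, h]
  rw [← hu, BB_act] at h1
  rcases wall j u h1 h2 with h | h
  · simp [← hu, h]
  · simp [← hu, h, act_neg]

abbrev WW : Subgroup ↥(OZ q3) := Subgroup.closure (Set.range ss)

theorem ss_inv (j) : (ss j)⁻¹ = ss j := inv_eq_of_mul_eq_one_right (ss_sq j)

theorem WW_ind {P : ↥(OZ q3) → Prop} (h1 : P 1) (h2 : ∀ g ∈ WW, ∀ j, P g → P (g * ss j)) :
    ∀ g ∈ WW, P g := by
  intro g hg
  induction hg using Subgroup.closure_induction_right with
  | one => exact h1
  | mul_right x hx y hy ih =>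
    obtain ⟨i, rfl⟩ := hy
    exact h2 x hx i ih
  | mul_inv_cancel x hx y hy ih =>
    obtain ⟨i, rfl⟩ := hy
    rw [ss_inv]
    exact h2 x hx i ih

theorem WW_C2 : ∀ g ∈ WW, C2 g := by
  apply WW_ind
  · intro v k; simp [act_one]
  · intro g _ j hg; exact C2_mul hg (C2_ss j)

theorem fin_supp : ∀ g ∈ WW, (Function.support (fun v => ff (act g pp) v - ff pp v)).Finite := by
  apply WW_ind
  · simp [act_one]
  · intro g _ j ih
    refine (ih.union ((Finset.finite_toSet _).subset (supp1 g j))).subset ?_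
    intro v hv
    by_contra h
    simp only [Set.mem_union, Function.mem_support, not_or, not_not] at h hv
    omega

theorem hh_one : hh 1 = 0 := by simp [hh, act_one]

def dl (j : Fin 6) (b : Prop) [Decidable b] : ℤ := if b then -BB (al j) pp else BB (al j) pp

theorem BB_al_pp (j) : BB (al j) pp = 1 ∨ BB (al j) pp = -1 := by revert j; decide

theorem BB_al_ss (j) : BB (al j) (act (ss j) pp) = -BB (al j) pp := by
  simp only [act_ss]; revert j; decide

theorem hh_step (g) (hg : g ∈ WW) (j) : hh (g * ss j) = hh g + dl j (pos (act g (al j))) := by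
  have e : hh (g * ss j) = hh g + ∑ᶠ v, (ff (act (g * ss j) pp) v - ff (act g pp) v) := by
    unfold hh
    rw [← finsum_add_distrib (fin_supp g hg) ((Finset.finite_toSet _).subset (supp1 g j))]
    congr 1
    funext v
    ring
  rw [e, finsum_eq_sum_of_support_subset _ (supp1 g j)]
  congr 1
  have h2 := pos_neg (act g (al j)) j (fun k => WW_C2 g hg (al j) k)
  have n1 : BB (act g (al j)) (act g (al j)) = 1 := by rw [BB_act, al_norm]
  have n2 : BB (-act g (al j)) (-act g (al j)) = 1 := by rw [← act_neg, BB_act, ← al_norm j]; simp [BB]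
  have b1 : BB (act g (al j)) (act g pp) = BB (al j) pp := BB_act _ _ _
  have b2 : BB (-act g (al j)) (act g pp) = -BB (al j) pp := by
    rw [← b1]; simp [BB]; ring
  have b3 : BB (act g (al j)) (act (g * ss j) pp) = -BB (al j) pp := by
    rw [act_mul, BB_act]
    exact BB_al_ss j
  have b4 : BB (-act g (al j)) (act (g * ss j) pp) = BB (al j) pp := by
    rw [← neg_neg (BB (al j) pp), ← b3]; simp [BB]; ring
  have hs := BB_al_pp j
  have ne : act g (al j) ≠ -act g (al j) := by
    intro h
    rw [← h] at h2
    tauto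
  rw [Finset.sum_pair ne]
  unfold ff dl
  rw [n1, n2, b1, b2, b3, b4]
  by_cases hp : pos (act g (al j))
  · have hn : ¬ pos (-act g (al j)) := by tauto
    simp only [hp, hn]
    rcases hs with h | h <;> rw [h] <;> simp
  · have hn : pos (-act g (al j)) := by tauto
    simp only [hp, hn]
    rcases hs with h | h <;> rw [h] <;> simp

def adj (i j : Fin 6) : Prop := i ≠ j ∧ BB (al i) (al j) = 0

instance : DecidableRel adj := fun i j => by unfold adj; infer_instance

def dp (b : Bool) (c : Bool) (d : Bool) : Fin 6 → ℤ :=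
  ![dl 0 (b = true), dl 1 (c = true), dl 2 (d = true), dl 3 (d = true), dl 4 (b = true), dl 5 (c = true)]

theorem link_fin : ∀ b c d : Bool, ∀ i j : Fin 6, dp b c d i = dp b c d j →
    i = j ∨ adj i j ∨ ∃ k, adj i k ∧ adj k j ∧ dp b c d k = dp b c d i := by
  decide

theorem dl_congr (j) {a b : Prop} [Decidable a] [Decidable b] (h : a ↔ b) : dl j a = dl j b := by
  unfold dl; simp [h]

theorem good : GoodH ss hh WW adj where
  inv := ss_sq
  mem := fun i => Subgroup.subset_closure ⟨i, rfl⟩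
  step := fun g hg i => by
    rw [hh_step g hg]
    have hs := BB_al_pp i
    unfold dl
    split_ifs <;> omega
  comm := fun i j h => ss_comm i j h.2
  sq := fun i j h g hg => by
    rw [hh_step _ (WW.mul_mem hg (Subgroup.subset_closure ⟨i, rfl⟩)), hh_step g hg j, act_mul,
      act_ss_orth i j h.2]
    ring
  link := fun g hg i j h => by
    obtain ⟨p1, p2, p3⟩ := pairing g (WW_C2 g hg)
    have key : ∀ k, hh (g * ss k) = hh g + dp (decide (pos (act g (al 0))))
        (decide (pos (act g (al 1)))) (decide (pos (act g (al 2)))) k := by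
      intro k
      rw [hh_step g hg]
      congr 1
      fin_cases k
      · exact dl_congr _ (by simp)
      · exact dl_congr _ (by simp)
      · exact dl_congr _ (by simp)
      · exact dl_congr _ (by simp [p3])
      · exact dl_congr _ (by simp [p1])
      · exact dl_congr _ (by simp [p2])
    simp only [key] at h ⊢
    simp only [add_right_inj] at h ⊢
    exact link_fin _ _ _ i j h

def ee : Fin 4 → ℤ := ![1,0,0,0]

theorem term_aux (x0 x1 x2 x3 : ℤ) (hq : -(x0 * x0) + x1 * x1 + x2 * x2 + x3 * x3 = -1)
    (h0 : 0 < x0) (h1 : 0 ≤ x1) (h2 : 0 ≤ x2) (h3 : 0 ≤ x3) (e3 : 2 ∣ x3)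
    (a : x1 + x2 ≤ x0) (l1 : x3 ≤ x1) (l2 : x3 ≤ x2) :
    x0 = 1 ∧ x1 = 0 ∧ x2 = 0 ∧ x3 = 0 := by
  have s : (x1 + x2) * (x1 + x2) ≤ x0 * x0 := by nlinarith
  have s1 : x3 * x3 ≤ x1 * x2 := by nlinarith
  have s2 : x3 * x3 ≤ 1 := by nlinarith
  have s3 : x3 ≤ 1 := by nlinarith
  obtain rfl : x3 = 0 := by omega
  have s4 : x1 * x2 = 0 := by nlinarith
  rcases mul_eq_zero.mp s4 with rfl | rfl
  · have : x2 < x0 := by nlinarith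
    have : x2 = 0 := by nlinarith
    subst this
    have : x0 = 1 := by nlinarith
    simp [this]
  · have : x1 < x0 := by nlinarith
    have : x1 = 0 := by nlinarith
    subst this
    have : x0 = 1 := by nlinarith
    simp [this]

theorem term_all (x0 x1 x2 x3 : ℤ) (hq : -(x0 * x0) + x1 * x1 + x2 * x2 + x3 * x3 = -1)
    (h0 : 0 < x0) (h1 : 0 ≤ x1) (h2 : 0 ≤ x2) (h3 : 0 ≤ x3)
    (e1 : 2 ∣ x1) (e2 : 2 ∣ x2) (e3 : 2 ∣ x3)
    (a : x1 + x2 ≤ x0) (b : x1 + x3 ≤ x0) (c : x2 + x3 ≤ x0) :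
    x0 = 1 ∧ x1 = 0 ∧ x2 = 0 ∧ x3 = 0 := by
  by_cases k1 : x3 ≤ x1 ∧ x3 ≤ x2
  · exact term_aux x0 x1 x2 x3 hq h0 h1 h2 h3 e3 a k1.1 k1.2
  by_cases k2 : x2 ≤ x1 ∧ x2 ≤ x3
  · have := term_aux x0 x1 x3 x2 (by linarith) h0 h1 h3 h2 e2 b k2.1 k2.2
    tauto
  · have := term_aux x0 x2 x3 x1 (by linarith) h0 h2 h3 h1 e1 c (by omega) (by omega)
    tauto

theorem vec_eq {u v : Fin 4 → ℤ} (h : u 0 = v 0 ∧ u 1 = v 1 ∧ u 2 = v 2 ∧ u 3 = v 3) : u = v := by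
  obtain ⟨h0, h1, h2, h3⟩ := h
  funext i; fin_cases i <;> assumption

theorem act_ext' {g h : ↥(OZ q3)} (h0 : act g ee = act h ee) (h1 : act g (al 0) = act h (al 0))
    (h2 : act g (al 1) = act h (al 1)) (h3 : act g (al 2) = act h (al 2)) : g = h := by
  apply act_ext
  intro v
  have : v = v 0 • ee + v 1 • al 0 + v 2 • al 1 + v 3 • al 2 := by
    apply vec_eq
    simp [ee, al]
  rw [this]
  simp only [act_add, act_smul, h0, h1, h2, h3]

theorem col_aux (x1 x2 x3 : ℤ) (h : x1 * x1 + x2 * x2 + x3 * x3 = 1) (h1 : 2 ∣ x1 - 1)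
    (h2 : 2 ∣ x2) (h3 : 2 ∣ x3) : (x1 = 1 ∨ x1 = -1) ∧ x2 = 0 ∧ x3 = 0 := by
  have b1 : -1 ≤ x1 ∧ x1 ≤ 1 := ⟨by nlinarith, by nlinarith⟩
  have b2 : -1 ≤ x2 ∧ x2 ≤ 1 := ⟨by nlinarith, by nlinarith⟩
  have b3 : -1 ≤ x3 ∧ x3 ≤ 1 := ⟨by nlinarith, by nlinarith⟩
  omega

theorem fix_mem (g) (hg : C2 g) (he : act g ee = ee) : g ∈ WW := by
  have m : ∀ i, ss i ∈ WW := fun i => Subgroup.subset_closure ⟨i, rfl⟩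
  have c0 : act g (al 0) = al 0 ∨ act g (al 0) = -al 0 := by
    have h0 := BB_act g (al 0) ee
    have h1 := BB_act g (al 0) (al 0)
    rw [he] at h0
    have p1 := hg (al 0) 1; have p2 := hg (al 0) 2; have p3 := hg (al 0) 3
    generalize act g (al 0) = x at *
    simp [BB, al, ee] at h0 h1 p1 p2 p3
    have := col_aux (x 1) (x 2) (x 3) (by rw [h0] at h1; linarith) p1 p2 p3
    rcases this with ⟨h | h, h', h''⟩
    · left; apply vec_eq; simp [al, *]
    · right; apply vec_eq; simp [al, *]
  have c1 : act g (al 1) = al 1 ∨ act g (al 1) = -al 1 := by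
    have h0 := BB_act g (al 1) ee
    have h1 := BB_act g (al 1) (al 1)
    rw [he] at h0
    have p1 := hg (al 1) 1; have p2 := hg (al 1) 2; have p3 := hg (al 1) 3
    generalize act g (al 1) = x at *
    simp [BB, al, ee] at h0 h1 p1 p2 p3
    have := col_aux (x 2) (x 1) (x 3) (by rw [h0] at h1; linarith) p2 p1 p3
    rcases this with ⟨h | h, h', h''⟩
    · left; apply vec_eq; simp [al, *]
    · right; apply vec_eq; simp [al, *]
  have c2 : act g (al 2) = al 2 ∨ act g (al 2) = -al 2 := by
    have h0 := BB_act g (al 2) ee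
    have h1 := BB_act g (al 2) (al 2)
    rw [he] at h0
    have p1 := hg (al 2) 1; have p2 := hg (al 2) 2; have p3 := hg (al 2) 3
    generalize act g (al 2) = x at *
    simp [BB, al, ee] at h0 h1 p1 p2 p3
    have := col_aux (x 3) (x 1) (x 2) (by rw [h0] at h1; linarith) p3 p1 p2
    rcases this with ⟨h | h, h', h''⟩
    · left; apply vec_eq; simp [al, *]
    · right; apply vec_eq; simp [al, *]
  have ae : ∀ i : Fin 3, act (ss (Fin.castLE (by decide) i)) ee = ee := by
    simp only [act_ss]; decide
  have r : ∀ i j : Fin 3, act (ss (Fin.castLE (by decide) i)) (al (Fin.castLE (by decide) j)) =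
      if i = j then -al (Fin.castLE (by decide) j) else al (Fin.castLE (by decide) j) := by
    simp only [act_ss]; decide
  have ae0 := ae 0
  have ae1 := ae 1
  have ae2 := ae 2
  have r00 := r 0 0
  have r01 := r 0 1
  have r02 := r 0 2
  have r10 := r 1 0
  have r11 := r 1 1
  have r12 := r 1 2
  have r20 := r 2 0
  have r21 := r 2 1
  have r22 := r 2 2
  simp at ae0 ae1 ae2 r00 r01 r02 r10 r11 r12 r20 r21 r22
  have key : g = (if act g (al 0) = al 0 then 1 else ss 0) *
      (if act g (al 1) = al 1 then 1 else ss 1) * (if act g (al 2) = al 2 then 1 else ss 2) := by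
    have n : ∀ j, -al j ≠ al j := by decide
    rcases c0 with h0 | h0 <;> rcases c1 with h1 | h1 <;> rcases c2 with h2 | h2 <;>
    apply act_ext' <;>
    simp [act_mul, act_one, act_neg, h0, h1, h2, he, n, ae0, ae1, ae2, r00, r01, r02, r10, r11,
      r12, r20, r21, r22]
  rw [key]
  refine WW.mul_mem (WW.mul_mem ?_ ?_) ?_ <;> split_ifs <;> simp only [m, WW.one_mem]

theorem descent_aux (j : Fin 6) (x : Fin 4 → ℤ) (hx : BB x x = -1) (h0 : 0 < x 0)
    (hj : BB x (al j) * BB (al j) pp < 0) :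
    0 < (x - (2 * BB x (al j)) • al j) 0 ∧
    - BB pp (x - (2 * BB x (al j)) • al j) < - BB pp x ∧ 0 < - BB pp x := by
  have h1 : - BB pp (x - (2 * BB x (al j)) • al j) = - BB pp x + 2 * (BB x (al j) * BB (al j) pp) := by
    simp [BB]; ring
  refine ⟨?_, by linarith, ?_⟩
  · simp only [BB] at hx hj ⊢
    have k : ∀ a b c : ℤ, -(x 0 * x 0) + a * a + b * b + c * c = -1 → 0 < 3 * x 0 - 2 * (a + b) := by
      intro a b c h
      by_contra hc
      nlinarith [sq_nonneg (a - b), sq_nonneg c]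
    have k1 := k (x 1) (x 2) (x 3) (by linarith)
    have k2 := k (x 1) (x 3) (x 2) (by linarith)
    have k3 := k (x 2) (x 3) (x 1) (by linarith)
    fin_cases j <;> simp [al] <;> linarith
  · simp only [BB, pp] at hx ⊢
    simp
    generalize x 0 = x0 at *
    generalize x 1 = x1 at *
    generalize x 2 = x2 at *
    generalize x 3 = x3 at *
    by_contra hc
    nlinarith [sq_nonneg (x1 - x2), sq_nonneg (x1 - x3), sq_nonneg (x2 - x3)]

theorem descent (n : ℕ) : ∀ g, C2 g → 0 < act g ee 0 → (- BB pp (act g ee)).toNat < n → g ∈ WW := by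
  induction n with
  | zero => intro g _ _ hn; omega
  | succ n ih =>
    intro g hg h0 hn
    have hx : BB (act g ee) (act g ee) = -1 := by rw [BB_act]; decide
    by_cases hj : ∃ j, BB (act g ee) (al j) * BB (al j) pp < 0
    · obtain ⟨j, hj⟩ := hj
      obtain ⟨k1, k2, k3⟩ := descent_aux j _ hx h0 hj
      rw [← act_ss, ← act_mul] at k1 k2
      have := ih (ss j * g) (C2_mul (C2_ss j) hg) k1 (by omega)
      have e : g = ss j * (ss j * g) := by rw [← mul_assoc, ss_sq, one_mul]
      rw [e]
      exact WW.mul_mem (Subgroup.subset_closure ⟨j, rfl⟩) this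
    · push Not at hj
      apply fix_mem g hg
      have p1 := hg ee 1
      have p2 := hg ee 2
      have p3 := hg ee 3
      have j0 := hj 0
      have j1 := hj 1
      have j2 := hj 2
      have j3 := hj 3
      have j4 := hj 4
      have j5 := hj 5
      generalize act g ee = x at *
      apply vec_eq
      simp [BB, al, pp, ee] at hx p1 p2 p3 j0 j1 j2 j3 j4 j5 ⊢
      exact term_all (x 0) (x 1) (x 2) (x 3) hx h0 j0 j1 j2 p1 p2 p3
        (by linarith) (by linarith) (by linarith)

theorem C2_mem (g) (hg : C2 g) : g ∈ WW ∨ zz * g ∈ WW := by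
  have h := hg ee 0
  simp only [ee, Matrix.cons_val_zero] at h
  by_cases h0 : 0 < act g ee 0
  · exact Or.inl (descent _ g hg h0 (Nat.lt_succ_self _))
  · right
    refine descent _ (zz * g) ?_ ?_ (Nat.lt_succ_self _)
    · intro v k
      have := hg v k
      rw [act_mul, act_zz, Pi.neg_apply]
      omega
    · rw [act_mul, act_zz, Pi.neg_apply]
      simp only [ee] at h0 ⊢
      omega

noncomputable def redm (n : ℕ) : ↥(OZ q3) →* GL (Fin 4) (ZMod n) :=
  (Matrix.GeneralLinearGroup.map (Int.castRingHom (ZMod n))).comp (OZ q3).subtype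

theorem redm_ker (n : ℕ) (g) (hg : g ∈ (redm n).ker) (v k) : (n : ℤ) ∣ act g v k - v k := by
  have h : ((g : GL (Fin 4) ℤ) : Matrix (Fin 4) (Fin 4) ℤ).map (Int.castRingHom (ZMod n)) = 1 :=
    congrArg Units.val (MonoidHom.mem_ker.mp hg)
  rw [← ZMod.intCast_zmod_eq_zero_iff_dvd]
  have e : ((act g v k : ℤ) : ZMod n) = (((g : GL (Fin 4) ℤ) : Matrix (Fin 4) (Fin 4) ℤ).map
      (Int.castRingHom (ZMod n)) *ᵥ (fun i => ((v i : ℤ) : ZMod n))) k := by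
    simp [act, Matrix.mulVec, dotProduct]
  rw [h, Matrix.one_mulVec] at e
  rw [Int.cast_sub, e, sub_self]

theorem redm_fin (n : ℕ) [NeZero n] : (redm n).ker.FiniteIndex := by
  have : Finite (GL (Fin 4) (ZMod n)) := inferInstance
  infer_instance

instance WW_fin : WW.FiniteIndex := by
  have := redm_fin 2
  let N := (redm 2).ker
  have : Function.Surjective (fun q : (↥(OZ q3) ⧸ N) × Bool =>
      ((q.1.out * (if q.2 then zz⁻¹ else 1) : ↥(OZ q3)) : ↥(OZ q3) ⧸ WW)) := by
    intro y
    obtain ⟨g, rfl⟩ := QuotientGroup.mk_surjective y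
    have hn : ((g : ↥(OZ q3) ⧸ N).out)⁻¹ * g ∈ N := by
      rw [← QuotientGroup.eq]; simp
    have c2 : C2 (((g : ↥(OZ q3) ⧸ N).out)⁻¹ * g) := fun v k => redm_ker 2 _ hn v k
    rcases C2_mem _ c2 with h | h
    · exact ⟨((g : ↥(OZ q3) ⧸ N), false), QuotientGroup.eq.mpr (by simpa using h)⟩
    · exact ⟨((g : ↥(OZ q3) ⧸ N), true), QuotientGroup.eq.mpr (by simpa [mul_assoc] using h)⟩
  have : Finite (↥(OZ q3) ⧸ WW) := Finite.of_surjective _ this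
  exact Subgroup.finiteIndex_of_finite_quotient

theorem hh_add (γ) (h4 : γ ∈ (redm 4).ker) (hw : γ ∈ WW) : ∀ g ∈ WW, hh (γ * g) = hh γ + hh g := by
  apply WW_ind
  · rw [hh_one, mul_one, add_zero]
  · intro g hg j ih
    rw [← mul_assoc, hh_step _ (WW.mul_mem hw hg), hh_step g hg, ih, add_assoc]
    congr 2
    apply dl_congr
    apply pos_congr
    intro k
    rw [act_mul]
    exact redm_ker 4 γ h4 _ k

theorem elt_mem : ss 0 * ss 4 * ss 0 * ss 4 ∈ (redm 4).ker := by
  rw [MonoidHom.mem_ker]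
  apply Units.ext
  change (Rm (al 0) * Rm (al 4) * Rm (al 0) * Rm (al 4)).map (Int.castRingHom (ZMod 4)) = 1
  have : Rm (al 0) * Rm (al 4) * Rm (al 0) * Rm (al 4) =
    !![9, -4, 0, -8; -4, 1, 0, 4; 0, 0, 1, 0; 8, -4, 0, -7] := by decide
  rw [this]
  ext i j
  fin_cases i <;> fin_cases j <;> decide

theorem elt_hh : hh (ss 0 * ss 4 * ss 0 * ss 4) = -4 := by
  have m : ∀ i, ss i ∈ WW := fun i => Subgroup.subset_closure ⟨i, rfl⟩
  rw [hh_step _ (WW.mul_mem (WW.mul_mem (m _) (m _)) (m _)), hh_step _ (WW.mul_mem (m _) (m _)),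
    hh_step _ (m _), ← one_mul (ss 0), hh_step _ WW.one_mem, hh_one]
  simp only [act_mul, act_one, act_ss]
  decide

/-- `O(q₃, ℤ)` contains a finite-index subgroup `Γ` admitting a surjection
onto `ℤ` with finitely generated kernel (coming from a fibration over the circle). -/
theorem O_q3_virtually_maps_onto_Z_with_fg_kernel :
    ∃ Γ : Subgroup ↥(OZ q3), Γ.FiniteIndex ∧
      ∃ φ : ↥Γ →* Multiplicative ℤ, Function.Surjective φ ∧ Group.FG ↥φ.ker := by
  have m : ∀ i, ss i ∈ WW := fun i => Subgroup.subset_closure ⟨i, rfl⟩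
  have := redm_fin 4
  have fi : ((redm 4).ker ⊓ WW).FiniteIndex := inferInstance
  exact ⟨(redm 4).ker ⊓ WW, fi, good.final hh_one _ inf_le_right
    (fun γ hγ => hh_add γ hγ.1 hγ.2)
    ⟨_, ⟨elt_mem, WW.mul_mem (WW.mul_mem (WW.mul_mem (m _) (m _)) (m _)) (m _)⟩,
      by rw [elt_hh]; decide⟩⟩

end Paper
end
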